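/- arXiv:1206.4749 — 4 statements merged into one kernel-verified Lean document; each statement's English description precedes it below -/
import Mathlib

section
/- Let X be a Banach space and let T : 𝓢(ℝ,ℝ) → X be a continuous linear map on the Schwartz space (an X-valued tempered distribution on ℝ). Then there exist m ∈ ℕ₀, a continuous function F : ℝ → X of polynomial growth (i.e. there are k ∈ ℕ and C ≥ 0 with ‖F(x)‖ ≤ C(1+|x|)^k for all x ∈ ℝ), such that T(ψ) = (−1)^m ∫_ℝ ψ^{(m)}(t) · F(t) dt for every ψ ∈ 𝓢(ℝ,ℝ); that is, T = F^{(m)} as a distribution. -/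
open MeasureTheory SchwartzMap

open Set Filter Topology

theorem abs_pow_mul_abs_integral_Iic_le (η : SchwartzMap ℝ ℝ) (h : ∫ t, η t = 0) (k : ℕ) (x : ℝ) :
    |x| ^ k * |∫ t in Iic x, η t| ≤ ∫ t, |t| ^ k * |η t| := by
  have hint : Integrable (fun t : ℝ => |t| ^ k * |η t|) := by
    simpa using η.integrable_pow_mul volume k
  have key : ∀ s : Set ℝ, MeasurableSet s → (∀ t ∈ s, |x| ≤ |t|) →
      |x| ^ k * |∫ t in s, η t| ≤ ∫ t, |t| ^ k * |η t| := by
    intro s hs hst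
    calc |x| ^ k * |∫ t in s, η t| ≤ |x| ^ k * ∫ t in s, |η t| := by
          gcongr
          exact abs_integral_le_integral_abs
      _ = ∫ t in s, |x| ^ k * |η t| := by rw [integral_const_mul]
      _ ≤ ∫ t in s, |t| ^ k * |η t| := by
          refine setIntegral_mono_on (η.integrable.abs.const_mul _).integrableOn
            hint.integrableOn hs fun t ht => ?_
          have := hst t ht
          gcongr
      _ ≤ ∫ t, |t| ^ k * |η t| :=
          setIntegral_le_integral hint (Eventually.of_forall fun t => by positivity)
  rcases le_total x 0 with hx | hx
  · refine key _ measurableSet_Iic fun t ht => ?_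
    rw [mem_Iic] at ht
    rw [abs_of_nonpos hx, abs_of_nonpos (ht.trans hx)]
    linarith
  · have hsum := intervalIntegral.integral_Iic_add_Ioi (b := x) (μ := volume)
      (f := η) η.integrable.integrableOn η.integrable.integrableOn
    have : ∫ t in Iic x, η t = -∫ t in Ioi x, η t := by linarith
    rw [this, abs_neg]
    refine key _ measurableSet_Ioi fun t ht => ?_
    rw [mem_Ioi] at ht
    rw [abs_of_nonneg hx, abs_of_nonneg (hx.trans ht.le)]
    exact ht.le

theorem hasDerivAt_integral_Iic (η : SchwartzMap ℝ ℝ) (x : ℝ) :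
    HasDerivAt (fun x => ∫ t in Iic x, η t) (η x) x := by
  have h1 : (fun x => ∫ t in Iic x, η t) =
      fun x => (∫ t in Iic 0, η t) + ∫ t in (0 : ℝ)..x, η t := by
    funext y
    rw [← intervalIntegral.integral_Iic_sub_Iic η.integrable.integrableOn
      η.integrable.integrableOn]
    ring
  rw [h1]
  exact (intervalIntegral.integral_hasDerivAt_right (η.integrable.intervalIntegrable)
    (η.continuous.stronglyMeasurableAtFilter _ _) η.continuous.continuousAt).const_add _

/-- The primitive vanishing at `-∞` of a Schwartz function with zero integral. -/
noncomputable def SchwartzMap.primitive (η : SchwartzMap ℝ ℝ) (h : ∫ t, η t = 0) :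
    SchwartzMap ℝ ℝ where
  toFun x := ∫ t in Iic x, η t
  smooth' := by
    have hd : deriv (fun x => ∫ t in Iic x, η t) = η :=
      funext fun x => (hasDerivAt_integral_Iic η x).deriv
    rw [contDiff_infty_iff_deriv, hd]
    exact ⟨fun x => (hasDerivAt_integral_Iic η x).differentiableAt, η.smooth ⊤⟩
  decay' k n := by
    have hd : deriv (fun x => ∫ t in Iic x, η t) = η :=
      funext fun x => (hasDerivAt_integral_Iic η x).deriv
    cases n with
    | zero =>
      refine ⟨∫ t, |t| ^ k * |η t|, fun x => ?_⟩
      rw [norm_iteratedFDeriv_zero]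
      exact abs_pow_mul_abs_integral_Iic_le η h k x
    | succ n =>
      refine ⟨SchwartzMap.seminorm ℝ k n η, fun x => ?_⟩
      rw [norm_iteratedFDeriv_eq_norm_iteratedDeriv, iteratedDeriv_succ', hd]
      exact η.le_seminorm' ℝ k n x

theorem SchwartzMap.primitive_apply (η : SchwartzMap ℝ ℝ) (h : ∫ t, η t = 0) (x : ℝ) :
    η.primitive h x = ∫ t in Iic x, η t := rfl

theorem SchwartzMap.deriv_primitive (η : SchwartzMap ℝ ℝ) (h : ∫ t, η t = 0) :
    deriv (η.primitive h) = η :=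
  funext fun x => (hasDerivAt_integral_Iic η x).deriv

theorem SchwartzMap.seminorm_primitive_zero_le (η : SchwartzMap ℝ ℝ) (h : ∫ t, η t = 0) (k : ℕ) :
    SchwartzMap.seminorm ℝ k 0 (η.primitive h) ≤ ∫ t, |t| ^ k * |η t| := by
  refine seminorm_le_bound' ℝ k 0 _ (integral_nonneg fun t => by positivity) fun x => ?_
  rw [iteratedDeriv_zero]
  exact abs_pow_mul_abs_integral_Iic_le η h k x

theorem SchwartzMap.seminorm_primitive_succ_le (η : SchwartzMap ℝ ℝ) (h : ∫ t, η t = 0)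
    (k n : ℕ) :
    SchwartzMap.seminorm ℝ k (n + 1) (η.primitive h) ≤ SchwartzMap.seminorm ℝ k n η := by
  refine seminorm_le_bound' ℝ k _ _ (apply_nonneg _ _) fun x => ?_
  rw [iteratedDeriv_succ', deriv_primitive]
  exact η.le_seminorm' ℝ k n x

theorem SchwartzMap.integral_Iic_deriv (ψ : SchwartzMap ℝ ℝ) (x : ℝ) :
    ∫ t in Iic x, deriv ψ t = ψ x := by
  rw [integral_Iic_of_hasDerivAt_of_tendsto' (fun y _ => ψ.hasDerivAt y)
    (derivCLM ℝ ℝ ψ).integrable.integrableOn (ψ.tendsto_cocompact.mono_left atBot_le_cocompact),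
    sub_zero]

theorem SchwartzMap.integral_Ioi_deriv (ψ : SchwartzMap ℝ ℝ) (x : ℝ) :
    ∫ t in Ioi x, deriv ψ t = -ψ x := by
  rw [integral_Ioi_of_hasDerivAt_of_tendsto' (fun y _ => ψ.hasDerivAt y)
    (derivCLM ℝ ℝ ψ).integrable.integrableOn (ψ.tendsto_cocompact.mono_left atTop_le_cocompact),
    zero_sub]

theorem SchwartzMap.integral_deriv_eq_zero (ψ : SchwartzMap ℝ ℝ) : ∫ t, deriv ψ t = 0 := by
  have hi : Integrable (deriv ψ) := (derivCLM ℝ ℝ ψ).integrable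
  rw [← intervalIntegral.integral_Iic_add_Ioi (b := 0) hi.integrableOn hi.integrableOn,
    integral_Iic_deriv, integral_Ioi_deriv, add_neg_cancel]

theorem exists_schwartzMap_integral_eq_one : ∃ θ : SchwartzMap ℝ ℝ, ∫ t, θ t = 1 := by
  let b : ContDiffBump (0 : ℝ) := ⟨1, 2, one_pos, one_lt_two⟩
  refine ⟨(b.hasCompactSupport_normed (μ := volume)).toSchwartzMap b.contDiff_normed, ?_⟩
  exact b.integral_normed

theorem SchwartzMap.integrable_one_add_pow_mul (φ : SchwartzMap ℝ ℝ) (k : ℕ) :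
    Integrable fun t : ℝ => (1 + |t|) ^ k * |φ t| := by
  have h := ((φ.integrable_pow_mul volume 0).add (φ.integrable_pow_mul volume k)).const_mul
    (2 ^ (k - 1))
  refine h.mono' (by fun_prop) (Eventually.of_forall fun t => ?_)
  simp only [Real.norm_eq_abs, abs_mul, abs_abs, abs_pow, Pi.add_apply, pow_zero, one_mul]
  rw [abs_of_nonneg (by positivity : 0 ≤ 1 + |t|)]
  calc (1 + |t|) ^ k * |φ t| ≤ (2 ^ (k - 1) * (1 ^ k + |t| ^ k)) * |φ t| := by
        gcongr
        exact add_pow_le zero_le_one (abs_nonneg t) k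
    _ = _ := by ring

theorem exists_leftInverse_deriv : ∃ J : SchwartzMap ℝ ℝ →ₗ[ℝ] SchwartzMap ℝ ℝ,
    (∀ ψ, J (derivCLM ℝ ℝ ψ) = ψ) ∧
    (∀ k, ∃ C : ℝ, 0 ≤ C ∧ ∀ φ, SchwartzMap.seminorm ℝ k 0 (J φ) ≤
      C * ∫ t, (1 + |t|) ^ k * |φ t|) ∧
    (∀ k n, ∃ C : ℝ, 0 ≤ C ∧ ∀ φ, SchwartzMap.seminorm ℝ k (n + 1) (J φ) ≤
      SchwartzMap.seminorm ℝ k n φ + C * ∫ t, |φ t|) := by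
  obtain ⟨θ, hθ⟩ := exists_schwartzMap_integral_eq_one
  let P : SchwartzMap ℝ ℝ →ₗ[ℝ] SchwartzMap ℝ ℝ :=
    LinearMap.id - ((integralCLM ℝ volume).toLinearMap.smulRight θ)
  have hPa : ∀ φ, P φ = φ - (∫ t, φ t) • θ := fun φ => rfl
  have hP : ∀ φ, ∫ t, P φ t = 0 := by
    intro φ
    have := (integralCLM ℝ volume).map_sub φ ((∫ t, φ t) • θ)
    rw [map_smul] at this
    simpa [hPa, hθ] using this
  have hPb : ∀ φ t, |P φ t| ≤ |φ t| + (∫ t, |φ t|) * |θ t| := by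
    intro φ t
    calc |P φ t| = |φ t - (∫ t, φ t) * θ t| := by simp [hPa]
      _ ≤ |φ t| + |(∫ t, φ t)| * |θ t| := by rw [← abs_mul]; exact abs_sub _ _
      _ ≤ _ := by gcongr; exact abs_integral_le_integral_abs
  refine ⟨{ toFun := fun φ => (P φ).primitive (hP φ), map_add' := ?_, map_smul' := ?_ },
    ?_, ?_, ?_⟩
  · intro φ ψ
    ext x
    simp only [primitive_apply, map_add, add_apply]
    exact integral_add (P φ).integrable.integrableOn (P ψ).integrable.integrableOn
  · intro c φ
    ext x
    simp only [primitive_apply, map_smul, smul_apply, RingHom.id_apply]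
    exact integral_smul _ _
  · intro ψ
    ext x
    have : P (derivCLM ℝ ℝ ψ) = derivCLM ℝ ℝ ψ := by
      have h0 := ψ.integral_deriv_eq_zero
      simp [hPa, h0]
    simp only [LinearMap.coe_mk, AddHom.coe_mk, primitive_apply, this]
    exact ψ.integral_Iic_deriv x
  · intro k
    have hnn : 0 ≤ ∫ t, |t| ^ k * |θ t| := integral_nonneg fun t => by positivity
    have hi : ∀ φ : SchwartzMap ℝ ℝ, Integrable (fun t : ℝ => |t| ^ k * |φ t|) := by
      intro φ
      simpa using φ.integrable_pow_mul volume k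
    refine ⟨1 + ∫ t, |t| ^ k * |θ t|, by positivity, fun φ => ?_⟩
    refine (seminorm_primitive_zero_le _ (hP φ) k).trans ?_
    have hle : ∫ t, |φ t| ≤ ∫ t, (1 + |t|) ^ k * |φ t| := by
      refine integral_mono φ.integrable.abs (φ.integrable_one_add_pow_mul k) fun t => ?_
      exact le_mul_of_one_le_left (abs_nonneg _) (one_le_pow₀ (by simp))
    calc ∫ t, |t| ^ k * |P φ t|
        ≤ ∫ t, (|t| ^ k * |φ t| + (∫ t, |φ t|) * (|t| ^ k * |θ t|)) := by
          refine integral_mono (hi _) ((hi φ).add ((hi θ).const_mul _)) fun t => ?_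
          calc |t| ^ k * |P φ t| ≤ |t| ^ k * (|φ t| + (∫ t, |φ t|) * |θ t|) := by
                gcongr; exact hPb φ t
            _ = _ := by ring
      _ = (∫ t, |t| ^ k * |φ t|) + (∫ t, |φ t|) * ∫ t, |t| ^ k * |θ t| := by
          rw [integral_add (hi φ) ((hi θ).const_mul _), integral_const_mul]
      _ ≤ (∫ t, (1 + |t|) ^ k * |φ t|) +
            (∫ t, (1 + |t|) ^ k * |φ t|) * ∫ t, |t| ^ k * |θ t| := by
          have hle' : ∫ t, |t| ^ k * |φ t| ≤ ∫ t, (1 + |t|) ^ k * |φ t| := by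
            refine integral_mono (hi φ) (φ.integrable_one_add_pow_mul k) fun t => ?_
            beta_reduce
            gcongr
            linarith
          gcongr
      _ = _ := by ring
  · intro k n
    refine ⟨SchwartzMap.seminorm ℝ k n θ, apply_nonneg _ _, fun φ => ?_⟩
    refine (seminorm_primitive_succ_le _ (hP φ) k n).trans ?_
    rw [hPa]
    refine (map_sub_le_add _ _ _).trans ?_
    rw [map_smul_eq_mul, mul_comm]
    gcongr
    exact abs_integral_le_integral_abs

/-- The signed indicator function of the interval from `0` to `t`. -/
noncomputable def signedIndicator (t x : ℝ) : ℝ :=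
  (Ioc 0 t).indicator 1 x - (Ioc t 0).indicator 1 x

theorem signedIndicator_sub_signedIndicator {s t : ℝ} (hst : s ≤ t) (x : ℝ) :
    signedIndicator t x - signedIndicator s x = (Ioc s t).indicator 1 x := by
  simp only [signedIndicator, indicator_apply, mem_Ioc, Pi.one_apply]
  grind

theorem measurable_uncurry_signedIndicator :
    Measurable (Function.uncurry signedIndicator) := by
  have h : Function.uncurry signedIndicator = fun p : ℝ × ℝ =>
      {q : ℝ × ℝ | 0 < q.2 ∧ q.2 ≤ q.1}.indicator 1 p -
        {q : ℝ × ℝ | q.1 < q.2 ∧ q.2 ≤ 0}.indicator 1 p := rfl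
  rw [h]
  refine (measurable_one.indicator ?_).sub (measurable_one.indicator ?_)
  · exact (measurableSet_lt measurable_const measurable_snd).inter
      (measurableSet_le measurable_snd measurable_fst)
  · exact (measurableSet_lt measurable_fst measurable_snd).inter
      (measurableSet_le measurable_snd measurable_const)

theorem integral_deriv_mul_signedIndicator (φ : SchwartzMap ℝ ℝ) (x : ℝ) :
    ∫ t, deriv φ t * signedIndicator t x = -φ x := by
  rcases lt_or_ge 0 x with hx | hx
  · have h : (fun t => deriv φ t * signedIndicator t x) = (Ici x).indicator (deriv φ) := by
      funext t
      simp only [signedIndicator, indicator_apply, mem_Ioc, mem_Ici, Pi.one_apply]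
      grind
    rw [h, integral_indicator measurableSet_Ici, integral_Ici_eq_integral_Ioi,
      φ.integral_Ioi_deriv]
  · have h : (fun t => deriv φ t * signedIndicator t x) =
        (Iio x).indicator (fun t => -deriv φ t) := by
      funext t
      simp only [signedIndicator, indicator_apply, mem_Ioc, mem_Iio, Pi.one_apply]
      grind
    rw [h, integral_indicator measurableSet_Iio, ← integral_Iic_eq_integral_Iio, integral_neg,
      φ.integral_Iic_deriv]

section SignedIndicatorL1

variable (μ : Measure ℝ) [IsLocallyFiniteMeasure μ]

/-- The signed indicator function of the interval from `0` to `t`, as an element of `L¹`. -/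
noncomputable def signedIndicatorL1 (t : ℝ) : Lp ℝ 1 μ :=
  indicatorConstLp 1 (measurableSet_Ioc (a := 0) (b := t)) measure_Ioc_lt_top.ne 1 -
    indicatorConstLp 1 (measurableSet_Ioc (a := t) (b := 0)) measure_Ioc_lt_top.ne 1

theorem coeFn_signedIndicatorL1 (t : ℝ) : signedIndicatorL1 μ t =ᵐ[μ] signedIndicator t := by
  filter_upwards [Lp.coeFn_sub (indicatorConstLp 1 (measurableSet_Ioc (a := 0) (b := t))
      (measure_Ioc_lt_top (μ := μ)).ne (1 : ℝ))
      (indicatorConstLp 1 (measurableSet_Ioc (a := t) (b := 0)) measure_Ioc_lt_top.ne 1),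
    indicatorConstLp_coeFn (p := 1) (hs := measurableSet_Ioc (a := 0) (b := t))
      (hμs := (measure_Ioc_lt_top (μ := μ)).ne) (c := (1 : ℝ)),
    indicatorConstLp_coeFn (p := 1) (hs := measurableSet_Ioc (a := t) (b := 0))
      (hμs := (measure_Ioc_lt_top (μ := μ)).ne) (c := (1 : ℝ))] with x h1 h2 h3
  rw [signedIndicatorL1, h1, Pi.sub_apply, h2, h3]
  rfl

theorem norm_signedIndicatorL1_sub (s t : ℝ) :
    ‖signedIndicatorL1 μ t - signedIndicatorL1 μ s‖ = |∫ _ in s..t, (1 : ℝ) ∂μ| := by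
  wlog hst : s ≤ t generalizing s t
  · rw [norm_sub_rev, this t s (le_of_not_ge hst), intervalIntegral.integral_symm, abs_neg]
  have h : signedIndicatorL1 μ t - signedIndicatorL1 μ s =
      indicatorConstLp 1 (measurableSet_Ioc (a := s) (b := t)) measure_Ioc_lt_top.ne 1 := by
    refine Lp.ext ?_
    filter_upwards [Lp.coeFn_sub (signedIndicatorL1 μ t) (signedIndicatorL1 μ s),
      coeFn_signedIndicatorL1 μ t, coeFn_signedIndicatorL1 μ s,
      indicatorConstLp_coeFn (p := 1) (hs := measurableSet_Ioc (a := s) (b := t))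
        (hμs := (measure_Ioc_lt_top (μ := μ)).ne) (c := (1 : ℝ))] with x h1 h2 h3 h4
    rw [h1, Pi.sub_apply, h2, h3, h4, signedIndicator_sub_signedIndicator hst]
    rfl
  rw [h, norm_indicatorConstLp one_ne_zero ENNReal.one_ne_top,
    intervalIntegral.integral_of_le hst]
  simp [abs_of_nonneg measureReal_nonneg]

theorem continuous_signedIndicatorL1 [NullSingletonClass μ] :
    Continuous (signedIndicatorL1 μ) := by
  have hint : ∀ a b : ℝ, IntervalIntegrable (fun _ => (1 : ℝ)) μ a b :=
    fun a b => intervalIntegrable_const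
  have hc := intervalIntegral.continuous_primitive hint 0
  rw [continuous_iff_continuousAt]
  intro s
  rw [ContinuousAt, tendsto_iff_norm_sub_tendsto_zero]
  have h := ((hc.tendsto s).sub_const (∫ _ in (0 : ℝ)..s, (1 : ℝ) ∂μ)).abs
  rw [sub_self, abs_zero] at h
  refine h.congr fun t => ?_
  rw [norm_signedIndicatorL1_sub, intervalIntegral.integral_interval_sub_left (hint _ _) (hint _ _)]

theorem integral_abs_signedIndicator (t : ℝ) :
    ∫ x, |signedIndicator t x| ∂μ = ‖signedIndicatorL1 μ t‖ := by
  rw [L1.norm_eq_integral_norm]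
  refine integral_congr_ae ?_
  filter_upwards [coeFn_signedIndicatorL1 μ t] with x hx
  rw [hx, Real.norm_eq_abs]

theorem integrable_signedIndicator (t : ℝ) : Integrable (signedIndicator t) μ :=
  (L1.integrable_coeFn (signedIndicatorL1 μ t)).congr (coeFn_signedIndicatorL1 μ t)

theorem exists_norm_signedIndicatorL1_le [μ.HasTemperateGrowth] :
    ∃ (k : ℕ) (C : ℝ), 0 ≤ C ∧ ∀ t, ‖signedIndicatorL1 μ t‖ ≤ C * (1 + |t|) ^ k := by
  have hint := μ.integrable_pow_neg_integrablePower
  set k := μ.integrablePower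
  refine ⟨k, ∫ x, (1 + ‖x‖) ^ (-(k : ℝ)) ∂μ, integral_nonneg fun x => by positivity, fun t => ?_⟩
  rw [← integral_abs_signedIndicator, ← integral_mul_const]
  refine integral_mono (integrable_signedIndicator μ t).abs (hint.mul_const _) fun x => ?_
  have h0 : 0 ≤ (1 + ‖x‖) ^ (-(k : ℝ)) * (1 + |t|) ^ k := by positivity
  have h1 : |x| ≤ |t| → 1 ≤ (1 + ‖x‖) ^ (-(k : ℝ)) * (1 + |t|) ^ k := by
    intro hxt
    rw [Real.rpow_neg (by positivity), Real.rpow_natCast, ← div_eq_inv_mul,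
      one_le_div (by positivity), Real.norm_eq_abs]
    gcongr
  by_cases hxt : |x| ≤ |t|
  · refine le_trans ?_ (h1 hxt)
    simp only [signedIndicator, indicator_apply, Pi.one_apply]
    split_ifs <;> norm_num
  · have : signedIndicator t x = 0 := by
      simp only [signedIndicator, indicator_apply, mem_Ioc, Pi.one_apply]
      grind
    simpa [this] using h0

theorem integrable_deriv_smul_signedIndicatorL1 [μ.HasTemperateGrowth] [NullSingletonClass μ]
    (φ : SchwartzMap ℝ ℝ) :
    Integrable fun t => deriv φ t • signedIndicatorL1 μ t := by
  obtain ⟨k, C, hC, h⟩ := exists_norm_signedIndicatorL1_le μ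
  refine (((derivCLM ℝ ℝ φ).integrable_one_add_pow_mul k).const_mul C).mono'
    (((derivCLM ℝ ℝ φ).continuous.smul (continuous_signedIndicatorL1 μ)).aestronglyMeasurable)
    (Eventually.of_forall fun t => ?_)
  rw [norm_smul, Real.norm_eq_abs, derivCLM_apply]
  calc |deriv φ t| * ‖signedIndicatorL1 μ t‖ ≤ |deriv φ t| * (C * (1 + |t|) ^ k) := by
        gcongr
        exact h t
    _ = _ := by ring

theorem toLp_eq_neg_integral_deriv_smul [μ.HasTemperateGrowth] [NullSingletonClass μ]
    (φ : SchwartzMap ℝ ℝ) :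
    φ.toLp 1 μ = -∫ t, deriv φ t • signedIndicatorL1 μ t := by
  have hint := integrable_deriv_smul_signedIndicatorL1 μ φ
  rw [← integral_neg]
  refine Lp.ext (Lp.ae_eq_of_forall_setIntegral_eq _ _ one_ne_zero ENNReal.one_ne_top
    (fun s _ _ => (L1.integrable_coeFn _).integrableOn)
    (fun s _ _ => (L1.integrable_coeFn _).integrableOn) fun s hs _ => ?_)
  let ℓ : Lp ℝ 1 μ →L[ℝ] ℝ := L1.integralCLM.comp (LpToLpRestrictCLM ℝ ℝ ℝ μ 1 s)
  have hℓ : ∀ f : Lp ℝ 1 μ, ℓ f = ∫ x in s, f x ∂μ := by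
    intro f
    change L1.integralCLM _ = _
    rw [← L1.integral_eq, L1.integral_eq_integral]
    exact integral_congr_ae (LpToLpRestrictCLM_coeFn ℝ s f)
  have hℓH : ∀ t, ℓ (signedIndicatorL1 μ t) = ∫ x in s, signedIndicator t x ∂μ := by
    intro t
    rw [hℓ]
    exact integral_congr_ae (ae_restrict_of_ae (coeFn_signedIndicatorL1 μ t))
  have hprod : Integrable (Function.uncurry fun t x => deriv φ t * signedIndicator t x)
      (volume.prod (μ.restrict s)) := by
    have hm : Measurable (Function.uncurry fun t x => deriv φ t * signedIndicator t x) :=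
      (((derivCLM ℝ ℝ φ).continuous.measurable).comp measurable_fst).mul
        measurable_uncurry_signedIndicator
    rw [integrable_prod_iff hm.aestronglyMeasurable]
    refine ⟨Eventually.of_forall fun t =>
      ((integrable_signedIndicator μ t).const_mul (deriv φ t)).integrableOn, ?_⟩
    refine hint.norm.mono' hm.norm.stronglyMeasurable.integral_prod_right'.aestronglyMeasurable
      (Eventually.of_forall fun t => ?_)
    simp only [Function.uncurry_apply_pair, norm_mul, norm_smul]
    rw [integral_const_mul, norm_mul, norm_norm, Real.norm_of_nonneg
      (integral_nonneg fun x => norm_nonneg _), ← integral_abs_signedIndicator]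
    gcongr
    exact setIntegral_le_integral (integrable_signedIndicator μ t).abs
      (Eventually.of_forall fun x => abs_nonneg _)
  rw [← hℓ (∫ t, _), integral_neg, map_neg, ← ℓ.integral_comp_comm hint]
  simp only [map_smul, hℓH, smul_eq_mul, ← integral_const_mul]
  rw [integral_integral_swap hprod]
  simp only [integral_deriv_mul_signedIndicator, integral_neg, neg_neg]
  exact integral_congr_ae (ae_restrict_of_ae (φ.coeFn_toLp 1 μ))

end SignedIndicatorL1

theorem exists_eq_neg_integral_deriv_smul {X : Type*} [NormedAddCommGroup X] [NormedSpace ℝ X]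
    [CompleteSpace X] (μ : Measure ℝ) [IsLocallyFiniteMeasure μ] [μ.HasTemperateGrowth]
    [NullSingletonClass μ] (L : SchwartzMap ℝ ℝ →ₗ[ℝ] X) (C : ℝ)
    (hL : ∀ φ, ‖L φ‖ ≤ C * ∫ x, |φ x| ∂μ) :
    ∃ F : ℝ → X, Continuous F ∧
      (∃ (k : ℕ) (C : ℝ), 0 ≤ C ∧ ∀ x : ℝ, ‖F x‖ ≤ C * (1 + |x|) ^ k) ∧
      ∀ φ, L φ = -∫ t, deriv φ t • F t := by
  have hdense : DenseRange (toLpCLM ℝ ℝ 1 μ).toLinearMap := denseRange_toLpCLM ENNReal.one_ne_top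
  have hbound : ∀ φ, ‖L φ‖ ≤ C * ‖(toLpCLM ℝ ℝ 1 μ).toLinearMap φ‖ := by
    intro φ
    rw [ContinuousLinearMap.coe_coe, toLpCLM_apply, norm_toLp_one]
    exact hL φ
  let S : Lp ℝ 1 μ →L[ℝ] X := L.extendOfNorm (toLpCLM ℝ ℝ 1 μ).toLinearMap
  have hS : ∀ φ : SchwartzMap ℝ ℝ, S (φ.toLp 1 μ) = L φ :=
    fun φ => LinearMap.extendOfNorm_eq hdense ⟨C, hbound⟩ φ
  refine ⟨fun t => S (signedIndicatorL1 μ t), S.continuous.comp (continuous_signedIndicatorL1 μ),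
    ?_, fun φ => ?_⟩
  · obtain ⟨k, A, hA, h⟩ := exists_norm_signedIndicatorL1_le μ
    refine ⟨k, ‖S‖ * A, by positivity, fun t => (S.le_opNorm _).trans ?_⟩
    rw [mul_assoc]
    gcongr
    exact h t
  · rw [← hS, toLp_eq_neg_integral_deriv_smul, map_neg, ← S.integral_comp_comm
      (integrable_deriv_smul_signedIndicatorL1 μ φ)]
    simp only [map_smul]

theorem exists_eq_neg_integral_deriv_smul_of_weighted {X : Type*} [NormedAddCommGroup X]
    [NormedSpace ℝ X] [CompleteSpace X] (L : SchwartzMap ℝ ℝ →ₗ[ℝ] X) (C : ℝ) (K : ℕ)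
    (hL : ∀ φ, ‖L φ‖ ≤ C * ∫ x, (1 + |x|) ^ K * |φ x|) :
    ∃ F : ℝ → X, Continuous F ∧
      (∃ (k : ℕ) (C : ℝ), 0 ≤ C ∧ ∀ x : ℝ, ‖F x‖ ≤ C * (1 + |x|) ^ k) ∧
      ∀ φ, L φ = -∫ t, deriv φ t • F t := by
  let w : ℝ → NNReal := fun x => (1 + ‖x‖₊) ^ K
  have hw : Continuous w := by fun_prop
  let μ : Measure ℝ := volume.withDensity fun x => (w x : ENNReal)
  have : IsLocallyFiniteMeasure μ := IsLocallyFiniteMeasure.withDensity_coe hw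
  have : NullSingletonClass μ :=
    ⟨fun x => withDensity_absolutelyContinuous _ _ (measure_singleton x)⟩
  have : μ.HasTemperateGrowth := by
    refine ⟨⟨K + 2, (integrable_withDensity_iff_integrable_smul hw.measurable).2 ?_⟩⟩
    have h2 : Integrable (fun x : ℝ => (1 + ‖x‖) ^ (-2 : ℝ)) :=
      integrable_one_add_norm (by simp)
    refine h2.congr (Eventually.of_forall fun x => ?_)
    have hpos : 0 < 1 + ‖x‖ := by positivity
    have hwx : ((w x : NNReal) : ℝ) = (1 + ‖x‖) ^ (K : ℝ) := by simp [w]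
    simp only [NNReal.smul_def, smul_eq_mul]
    rw [hwx, ← Real.rpow_add hpos]
    push_cast
    ring_nf
  refine exists_eq_neg_integral_deriv_smul μ L C fun φ => (hL φ).trans_eq ?_
  rw [integral_withDensity_eq_integral_smul hw.measurable]
  simp [NNReal.smul_def, w]

/-- The sum of the Schwartz seminorms with weights of degree less than `K` and at most `n`
derivatives. -/
noncomputable def seminormSum (n K : ℕ) (φ : SchwartzMap ℝ ℝ) : ℝ :=
  ∑ p ∈ Finset.range K ×ˢ Finset.range (n + 1), SchwartzMap.seminorm ℝ p.1 p.2 φ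

theorem seminormSum_mono {n m K M : ℕ} (hn : n ≤ m) (hK : K ≤ M) (φ : SchwartzMap ℝ ℝ) :
    seminormSum n K φ ≤ seminormSum m M φ :=
  Finset.sum_le_sum_of_subset_of_nonneg
    (Finset.product_subset_product (Finset.range_subset_range.2 hK)
      (Finset.range_subset_range.2 (by lia))) fun _ _ _ => apply_nonneg _ _

/-- A function on the Schwartz space is of order at most `n` if it is controlled by the Schwartz
seminorms that involve at most `n` derivatives. -/
def IsOfOrder (n : ℕ) (q : SchwartzMap ℝ ℝ → ℝ) : Prop :=
  ∃ (C : ℝ) (K : ℕ), 0 ≤ C ∧ ∀ φ, q φ ≤ C * seminormSum n K φ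

namespace IsOfOrder

variable {n m : ℕ} {q r : SchwartzMap ℝ ℝ → ℝ}

theorem mono (hq : IsOfOrder n q) (h : ∀ φ, r φ ≤ q φ) : IsOfOrder n r := by
  obtain ⟨C, K, hC, hb⟩ := hq
  exact ⟨C, K, hC, fun φ => (h φ).trans (hb φ)⟩

theorem zero : IsOfOrder n fun _ => 0 := ⟨0, 0, le_rfl, by simp⟩

theorem add (hq : IsOfOrder n q) (hr : IsOfOrder n r) : IsOfOrder n fun φ => q φ + r φ := by
  obtain ⟨C, K, hC, hb⟩ := hq
  obtain ⟨D, M, hD, hd⟩ := hr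
  refine ⟨C + D, max K M, by positivity, fun φ => ?_⟩
  rw [add_mul]
  refine add_le_add ((hb φ).trans ?_) ((hd φ).trans ?_)
  · gcongr
    exact seminormSum_mono le_rfl (le_max_left _ _) φ
  · gcongr
    exact seminormSum_mono le_rfl (le_max_right _ _) φ

theorem const_mul (hq : IsOfOrder n q) {c : ℝ} (hc : 0 ≤ c) : IsOfOrder n fun φ => c * q φ := by
  obtain ⟨C, K, hC, hb⟩ := hq
  refine ⟨c * C, K, by positivity, fun φ => ?_⟩
  rw [mul_assoc]
  exact mul_le_mul_of_nonneg_left (hb φ) hc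

theorem sum {ι : Type*} (s : Finset ι) {f : ι → SchwartzMap ℝ ℝ → ℝ}
    (h : ∀ i ∈ s, IsOfOrder n (f i)) : IsOfOrder n fun φ => ∑ i ∈ s, f i φ := by
  classical
  induction s using Finset.induction_on with
  | empty => simpa using zero
  | insert i s hi ih =>
    simp only [Finset.sum_insert hi]
    exact (h i (Finset.mem_insert_self i s)).add
      (ih fun j hj => h j (Finset.mem_insert_of_mem hj))

theorem seminorm (k : ℕ) {j : ℕ} (hj : j ≤ n) :
    IsOfOrder n (SchwartzMap.seminorm ℝ (E := ℝ) (F := ℝ) k j) := by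
  refine ⟨1, k + 1, zero_le_one, fun φ => ?_⟩
  rw [one_mul]
  exact Finset.single_le_sum (f := fun p : ℕ × ℕ => SchwartzMap.seminorm ℝ p.1 p.2 φ)
    (fun _ _ => apply_nonneg _ _) (a := (k, j)) (by simp; lia)

theorem integral_pow_mul_abs (k : ℕ) : IsOfOrder n fun φ => ∫ t, |t| ^ k * |φ t| := by
  have h := ((seminorm (n := n) 0 (Nat.zero_le n)).add (seminorm (n := n)
    (k + (volume : Measure ℝ).integrablePower) (Nat.zero_le n))).const_mul
    (c := 2 ^ (volume : Measure ℝ).integrablePower *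
      ∫ x : ℝ, (1 + ‖x‖) ^ (-((volume : Measure ℝ).integrablePower : ℝ)))
    (mul_nonneg (by positivity) (integral_nonneg fun x => by positivity))
  refine h.mono fun φ => ?_
  simpa using φ.integral_pow_mul_iteratedFDeriv_le ℝ (μ := volume) k 0

theorem integral_one_add_pow_mul_abs (k : ℕ) :
    IsOfOrder n fun φ => ∫ t, (1 + |t|) ^ k * |φ t| := by
  refine (((integral_pow_mul_abs 0).add (integral_pow_mul_abs k)).const_mul
    (c := 2 ^ (k - 1)) (by positivity)).mono fun φ => ?_
  have h0 : Integrable fun t : ℝ => |t| ^ 0 * |φ t| := by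
    simpa using φ.integrable_pow_mul volume 0
  have hk : Integrable fun t : ℝ => |t| ^ k * |φ t| := by
    simpa using φ.integrable_pow_mul volume k
  rw [← integral_add h0 hk, ← integral_const_mul]
  refine integral_mono (φ.integrable_one_add_pow_mul k) ((h0.add hk).const_mul _) fun t => ?_
  calc (1 + |t|) ^ k * |φ t| ≤ (2 ^ (k - 1) * (1 ^ k + |t| ^ k)) * |φ t| := by
        gcongr
        exact add_pow_le zero_le_one (abs_nonneg t) k
    _ = _ := by ring

end IsOfOrder

theorem ContinuousLinearMap.exists_isOfOrder {X : Type*} [NormedAddCommGroup X] [NormedSpace ℝ X]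
    (T : SchwartzMap ℝ ℝ →L[ℝ] X) : ∃ n, IsOfOrder n fun φ => ‖T φ‖ := by
  obtain ⟨s, C, -, hC⟩ := Seminorm.bound_of_continuous (schwartz_withSeminorms ℝ ℝ ℝ)
    ((normSeminorm ℝ X).comp T.toLinearMap) (continuous_norm.comp T.continuous)
  refine ⟨s.sup Prod.snd, ((IsOfOrder.sum s (f := fun p => SchwartzMap.seminorm ℝ p.1 p.2)
    fun p hp => IsOfOrder.seminorm p.1 (Finset.le_sup (f := Prod.snd) hp)).const_mul
    C.coe_nonneg).mono fun φ => ?_⟩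
  refine (hC φ).trans ?_
  change (C : ℝ) * _ ≤ _
  gcongr
  refine (Seminorm.finset_sup_le_sum _ s φ).trans_eq ?_
  exact map_sum (⟨⟨fun p => p φ, rfl⟩, fun _ _ => rfl⟩ : Seminorm ℝ (SchwartzMap ℝ ℝ) →+ ℝ) _ s

/-- A linear map on the Schwartz space is the `m`-th distributional derivative of a continuous
function of polynomial growth. -/
def IsDerivOfPolynomialGrowth {X : Type*} [NormedAddCommGroup X] [NormedSpace ℝ X]
    (m : ℕ) (L : SchwartzMap ℝ ℝ → X) : Prop :=
  ∃ F : ℝ → X, Continuous F ∧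
    (∃ (k : ℕ) (C : ℝ), 0 ≤ C ∧ ∀ x : ℝ, ‖F x‖ ≤ C * (1 + |x|) ^ k) ∧
    ∀ ψ : SchwartzMap ℝ ℝ, L ψ = ((-1 : ℝ) ^ m) • ∫ t : ℝ, (iteratedDeriv m (⇑ψ) t) • F t

theorem IsDerivOfPolynomialGrowth.of_comp_leftInverse {X : Type*} [NormedAddCommGroup X]
    [NormedSpace ℝ X] {m : ℕ} {L : SchwartzMap ℝ ℝ → X} {J : SchwartzMap ℝ ℝ → SchwartzMap ℝ ℝ}
    (hJ : ∀ ψ, J (derivCLM ℝ ℝ ψ) = ψ) (h : IsDerivOfPolynomialGrowth m fun φ => L (J φ)) :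
    IsDerivOfPolynomialGrowth (m + 1) L := by
  obtain ⟨F, hF, ⟨k, C, hC, hg⟩, h⟩ := h
  refine ⟨fun t => -F t, hF.neg, ⟨k, C, hC, by simpa using hg⟩, fun ψ => ?_⟩
  have hd : (derivCLM ℝ ℝ ψ : ℝ → ℝ) = deriv ψ := rfl
  have := h (derivCLM ℝ ℝ ψ)
  simp only [hJ, hd] at this
  simp only [this, iteratedDeriv_succ', smul_neg, integral_neg, pow_succ, mul_neg_one, neg_smul,
    neg_neg]

theorem exists_isDerivOfPolynomialGrowth {X : Type*} [NormedAddCommGroup X] [NormedSpace ℝ X]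
    [CompleteSpace X] (n : ℕ) (L : SchwartzMap ℝ ℝ →ₗ[ℝ] X) (hL : IsOfOrder n fun φ => ‖L φ‖) :
    ∃ m, IsDerivOfPolynomialGrowth m L := by
  obtain ⟨J, hJD, hJ0, hJs⟩ := exists_leftInverse_deriv
  induction n generalizing L with
  | zero =>
    obtain ⟨C, K, hC, hb⟩ := hL
    choose A hA hJA using hJ0
    have hbound : ∀ φ, ‖(L ∘ₗ J) φ‖ ≤
        (C * ∑ k ∈ Finset.range K, A k) * ∫ x, (1 + |x|) ^ K * |φ x| := by
      intro φ
      refine (hb (J φ)).trans ?_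
      rw [mul_assoc, Finset.sum_mul]
      gcongr
      rw [seminormSum, zero_add, Finset.sum_product]
      simp only [Finset.sum_range_one]
      gcongr with k hk
      refine (hJA k φ).trans (mul_le_mul_of_nonneg_left ?_ (hA k))
      refine integral_mono (φ.integrable_one_add_pow_mul k) (φ.integrable_one_add_pow_mul K)
        fun t => ?_
      beta_reduce
      gcongr
      · simp
      · exact (Finset.mem_range.1 hk).le
    obtain ⟨F, hF, hg, h⟩ := exists_eq_neg_integral_deriv_smul_of_weighted _ _ K hbound
    have h1 : IsDerivOfPolynomialGrowth 1 fun φ => L (J φ) :=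
      ⟨F, hF, hg, fun ψ => by simpa using h ψ⟩
    exact ⟨2, h1.of_comp_leftInverse hJD⟩
  | succ n ih =>
    have hLJ : IsOfOrder n fun φ => ‖(L ∘ₗ J) φ‖ := by
      obtain ⟨C, K, hC, hb⟩ := hL
      suffices h : IsOfOrder n fun φ => seminormSum (n + 1) K (J φ) from
        (h.const_mul hC).mono fun φ => hb (J φ)
      unfold seminormSum
      apply IsOfOrder.sum
      rintro ⟨k, j⟩ hp
      cases j with
      | zero =>
        obtain ⟨A, hA, h⟩ := hJ0 k
        exact ((IsOfOrder.integral_one_add_pow_mul_abs k).const_mul hA).mono h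
      | succ j =>
        obtain ⟨A, hA, h⟩ := hJs k j
        refine ((IsOfOrder.seminorm k (j := j) ?_).add
          ((IsOfOrder.integral_pow_mul_abs 0).const_mul hA)).mono fun φ => (h φ).trans_eq ?_
        · simp only [Finset.mem_product, Finset.mem_range] at hp
          lia
        · simp
    obtain ⟨m, hm⟩ := ih _ hLJ
    exact ⟨m + 1, hm.of_comp_leftInverse hJD⟩

/-- structure theorem for vector-valued tempered distributions,
Theorem 2.16 (a)⇒(c).  Every continuous linear `T : 𝓢(ℝ,ℝ) → X` is of the form
`T = F^{(m)}` for a continuous `F : ℝ → X` of polynomial growth, i.e.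
`T(ψ) = (−1)^m ∫_ℝ ψ^{(m)}(t) • F(t) dt` for all Schwartz functions `ψ`. -/
theorem thm_2_16_structure {X : Type*} [NormedAddCommGroup X] [NormedSpace ℝ X]
    [CompleteSpace X]
    (T : SchwartzMap ℝ ℝ →L[ℝ] X) :
    ∃ (m : ℕ) (F : ℝ → X), Continuous F ∧
      (∃ (k : ℕ) (C : ℝ), 0 ≤ C ∧ ∀ x : ℝ, ‖F x‖ ≤ C * (1 + |x|) ^ k) ∧
      ∀ ψ : SchwartzMap ℝ ℝ,
        T ψ = ((-1 : ℝ) ^ m) • ∫ t : ℝ, (iteratedDeriv m (⇑ψ) t) • F t := by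
  obtain ⟨n, hn⟩ := T.exists_isOfOrder
  exact exists_isDerivOfPolynomialGrowth n T.toLinearMap hn
end

section
/- Let I ⊆ ℝ be an arbitrary interval, 𝕂 = ℝ or ℂ, and let f : I → 𝕂 be an arbitrary function such that for each h > 0 the difference function t ↦ f(t+h) − f(t) is continuous on I ∩ (I − h). Then there exist a continuous function g : I → 𝕂 and an additive function H : ℝ → 𝕂 (i.e. H(s+t) = H(s) + H(t) for all s,t ∈ ℝ) such that f(t) = g(t) + H(t) for all t ∈ I. -/
open Set

open MeasureTheory Topology Filter

/-- If all differences of `f` on a compact group are continuous, then the family of all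
these differences is uniformly equicontinuous. -/
theorem exists_forall_norm_difference_sub_le {G E : Type*} [NormedAddCommGroup G]
    [CompactSpace G] [NormedAddCommGroup E] {f : G → E}
    (hf : ∀ h, Continuous fun t => f (t + h) - f t) {ε : ℝ} (hε : 0 < ε) :
    ∃ δ > 0, ∀ h t s, dist t s < δ →
      ‖(f (t + h) - f t) - (f (s + h) - f s)‖ ≤ 2 * ε := by
  have huc (k : G) {ε : ℝ} (hε : 0 < ε) : ∃ δ > 0, ∀ t s, dist t s < δ →
      ‖(f (t + k) - f t) - (f (s + k) - f s)‖ ≤ ε := by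
    obtain ⟨δ, hδ, h⟩ := Metric.uniformContinuous_iff.1
      (CompactSpace.uniformContinuous_of_continuous (hf k)) ε hε
    refine ⟨δ, hδ, fun t s hts => ?_⟩
    rw [← dist_eq_norm]
    exact (h hts).le
  let A : ℕ → Set G := fun n => {h | ∀ t s : G, dist t s < 1 / ((n : ℝ) + 1) →
    ‖(f (t + h) - f t) - (f (s + h) - f s)‖ ≤ ε}
  have hA (n : ℕ) : IsClosed (A n) := by
    simp only [A, ofPred_forall]
    refine isClosed_iInter fun t => isClosed_iInter fun s => isClosed_iInter fun _ => ?_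
    refine isClosed_le (Continuous.norm ?_) continuous_const
    have h1 : Continuous fun h => (f ((s + h) + (t - s)) - f (s + h)) - (f t - f s) :=
      ((hf (t - s)).comp (continuous_const.add continuous_id)).sub continuous_const
    convert h1 using 2 with h
    rw [show s + h + (t - s) = t + h by abel]
    abel
  have hU : ⋃ n, A n = univ := by
    refine eq_univ_of_forall fun h => mem_iUnion.2 ?_
    obtain ⟨δ, hδ, hh⟩ := huc h hε
    obtain ⟨n, hn⟩ := exists_nat_one_div_lt hδ
    exact ⟨n, fun t s hts => hh t s (hts.trans hn)⟩
  obtain ⟨n, u, hu⟩ := nonempty_interior_of_iUnion_of_closed hA hU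
  suffices H : ∃ δ > 0, ∀ h ∈ (univ : Set G), ∀ t s, dist t s < δ →
      ‖(f (t + h) - f t) - (f (s + h) - f s)‖ ≤ 2 * ε by simpa using H
  refine isCompact_univ.induction_on (p := fun S => ∃ δ > 0, ∀ h ∈ S, ∀ t s, dist t s < δ →
      ‖(f (t + h) - f t) - (f (s + h) - f s)‖ ≤ 2 * ε) ⟨1, one_pos, by simp⟩ ?_ ?_ ?_
  · rintro S T hST ⟨δ, hδ, h⟩
    exact ⟨δ, hδ, fun k hk => h k (hST hk)⟩
  · rintro S T ⟨δ, hδ, h⟩ ⟨δ', hδ', h'⟩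
    refine ⟨min δ δ', lt_min hδ hδ', ?_⟩
    rintro k (hk | hk) t s hts
    · exact h k hk t s (hts.trans_le (min_le_left _ _))
    · exact h' k hk t s (hts.trans_le (min_le_right _ _))
  · intro h₀ _
    obtain ⟨δ, hδ, hk⟩ := huc (h₀ - u) hε
    have hc : Tendsto (fun h => h - (h₀ - u)) (𝓝 h₀) (𝓝 u) := by
      have : Continuous fun h : G => h - (h₀ - u) := by fun_prop
      simpa using this.tendsto h₀
    refine ⟨_, mem_nhdsWithin_of_mem_nhds (hc (mem_interior_iff_mem_nhds.1 hu)),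
      min δ (1 / ((n : ℝ) + 1)), lt_min hδ (by positivity), ?_⟩
    intro h hh t s hts
    have h1 := hk (t + (h - (h₀ - u))) (s + (h - (h₀ - u)))
      (by rw [dist_add_right]; exact hts.trans_le (min_le_left _ _))
    have h2 := hh t s (hts.trans_le (min_le_right _ _))
    have h3 := norm_add_le_of_le h1 h2
    simp only [add_assoc, sub_add_cancel] at h3
    convert h3 using 1
    · congr 1; abel
    · ring

/-- **De Bruijn's theorem** on a compact abelian group: a function all of whose differences
are continuous is the sum of a continuous function and an additive one. -/
theorem exists_additive_continuous_sub_of_compactSpace {G E : Type*} [NormedAddCommGroup G]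
    [CompactSpace G] [MeasurableSpace G] [BorelSpace G] [NormedAddCommGroup E]
    [NormedSpace ℝ E] [CompleteSpace E] (μ : Measure G) [IsProbabilityMeasure μ]
    [μ.IsAddLeftInvariant] {f : G → E} (hf : ∀ h, Continuous fun t => f (t + h) - f t) :
    ∃ H : G → E, (∀ s t, H (s + t) = H s + H t) ∧ Continuous fun t => f t - H t := by
  have hint (h : G) : Integrable (fun t => f (t + h) - f t) μ :=
    (hf h).integrable_of_hasCompactSupport (HasCompactSupport.of_compactSpace _)
  have hadd (s t : G) : ∫ x, (f (x + (s + t)) - f x) ∂μ =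
      (∫ x, (f (x + s) - f x) ∂μ) + ∫ x, (f (x + t) - f x) ∂μ := by
    have h1 := integral_add_left_eq_self (μ := μ) (fun x => f (x + s) - f x) t
    have h2 : Integrable (fun x => f (t + x + s) - f (t + x)) μ :=
      (hint s).comp_add_left t
    rw [← h1, ← integral_add h2 (hint t)]
    congr 1 with x
    rw [show x + (s + t) = t + x + s by abel, add_comm x t]
    abel
  refine ⟨fun h => ∫ t, (f (t + h) - f t) ∂μ, hadd, ?_⟩
  rw [Metric.continuous_iff]
  intro b ε hε
  obtain ⟨δ, hδ, h⟩ := exists_forall_norm_difference_sub_le hf (ε := ε / 4) (by positivity)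
  refine ⟨δ, hδ, fun a hab => ?_⟩
  have ha := hadd b (a - b)
  rw [add_sub_cancel] at ha
  have key : ‖∫ y, ((f a - f b) - (f (y + (a - b)) - f y)) ∂μ‖ ≤ 2 * (ε / 4) := by
    refine (norm_integral_le_of_norm_le_const (C := 2 * (ε / 4)) (.of_forall fun y => ?_)).trans ?_
    · have := h (y - b) a b hab
      rw [show b + (y - b) = y by abel, show a + (y - b) = y + (a - b) by abel] at this
      rw [norm_sub_rev]
      convert this using 1
      congr 1
      abel
    · simp
  rw [integral_sub (integrable_const _) (hint _)] at key
  simp only [integral_const, probReal_univ, one_smul] at key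
  simp only [dist_eq_norm, ha]
  refine lt_of_le_of_lt (le_of_eq_of_le ?_ key) (by linarith)
  congr 1
  abel

/-- De Bruijn's theorem on a compact interval, for a function with equal values at both ends. -/
theorem exists_additive_continuousOn_sub_of_eq_endpoints {E : Type*} [NormedAddCommGroup E]
    [NormedSpace ℝ E] [CompleteSpace E] {a p : ℝ} (hp : 0 < p) {f : ℝ → E}
    (hfa : f a = f (a + p))
    (hf : ∀ h, 0 < h → ContinuousOn (fun t => f (t + h) - f t) (Icc a (a + p - h))) :
    ∃ H : ℝ → E, (∀ s t, H (s + t) = H s + H t) ∧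
      ContinuousOn (fun t => f t - H t) (Icc a (a + p)) := by
  have : Fact (0 < p) := ⟨hp⟩
  set F : AddCircle p → E := AddCircle.liftIco p a f with hF
  have hFf {t : ℝ} (ht : t ∈ Icc a (a + p)) : F t = f t := by
    rcases ht.2.lt_or_eq with h | rfl
    · exact AddCircle.liftIco_coe_apply ⟨ht.1, h⟩
    · rw [AddCircle.coe_add_period, hF,
        AddCircle.liftIco_coe_apply (left_mem_Ico.2 (by linarith)), hfa]
  have hFc (h : AddCircle p) : Continuous fun t => F (t + h) - F t := by
    obtain ⟨h, hh, rfl⟩ : ∃ r ∈ Ico (0 : ℝ) (0 + p), (r : AddCircle p) = h := by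
      have := AddCircle.coe_image_Ico_eq p 0
      exact (this ▸ mem_univ h : h ∈ ((↑) : ℝ → AddCircle p) '' Ico 0 (0 + p))
    rw [zero_add] at hh
    rcases hh.1.eq_or_lt with rfl | h0
    · simpa using continuous_const
    let φ : ℝ → E := fun t => F ((t + h : ℝ) : AddCircle p) - F (t : AddCircle p)
    have hφ : ContinuousOn φ (Icc a (a + p)) := by
      have h1 : ContinuousOn φ (Icc a (a + p - h)) := by
        refine (hf h h0).congr fun t ht => ?_
        simp only [φ]
        rw [hFf ⟨by linarith [ht.1], by linarith [ht.2]⟩, hFf ⟨ht.1, by linarith [ht.2]⟩]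
      have h2 : ContinuousOn φ (Icc (a + p - h) (a + p)) := by
        have hc : ContinuousOn (fun t => -(f (t + h - p + (p - h)) - f (t + h - p)))
            (Icc (a + p - h) (a + p)) :=
          ((hf (p - h) (by linarith [hh.2])).comp (f := fun t => t + h - p) (by fun_prop)
            (fun t ht => ⟨by linarith [ht.1], by linarith [ht.2]⟩)).neg
        refine hc.congr fun t ht => ?_
        have e : ((t + h : ℝ) : AddCircle p) = ((t + h - p : ℝ) : AddCircle p) := by
          rw [AddCircle.coe_sub, AddCircle.coe_period, sub_zero]
        simp only [φ]
        rw [e, hFf ⟨by linarith [ht.1], by linarith [ht.2, hh.2]⟩,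
          hFf ⟨by linarith [ht.1, hh.2], ht.2⟩, neg_sub, show t + h - p + (p - h) = t by ring]
      rw [← Icc_union_Icc_eq_Icc (b := a + p - h) (by linarith [hh.2]) (by linarith)]
      exact h1.union_of_isClosed h2 isClosed_Icc isClosed_Icc
    have hφF : (fun t => F (t + (h : AddCircle p)) - F t) = AddCircle.liftIco p a φ := by
      ext x
      obtain ⟨t, ht, rfl⟩ : ∃ r ∈ Ico a (a + p), (r : AddCircle p) = x := by
        have := AddCircle.coe_image_Ico_eq p a
        exact (this ▸ mem_univ x : x ∈ ((↑) : ℝ → AddCircle p) '' Ico a (a + p))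
      rw [AddCircle.liftIco_coe_apply ht]
      simp only [φ, AddCircle.coe_add]
    rw [hφF]
    refine AddCircle.liftIco_continuous ?_ hφ
    simp only [φ]
    rw [add_right_comm, AddCircle.coe_add_period, AddCircle.coe_add_period]
  obtain ⟨H, hH, hc⟩ :=
    exists_additive_continuous_sub_of_compactSpace (AddCircle.haarAddCircle (T := p)) hFc
  refine ⟨fun t => H t, fun s t => by simp only [AddCircle.coe_add, hH], ?_⟩
  refine (hc.comp (AddCircle.continuous_mk' p)).continuousOn.congr fun t ht => ?_
  simp only [Function.comp_apply]
  rw [← hFf ht]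
  rfl

/-- De Bruijn's theorem on a nondegenerate compact interval. -/
theorem exists_additive_continuousOn_sub_Icc {E : Type*} [NormedAddCommGroup E]
    [NormedSpace ℝ E] [CompleteSpace E] {a b : ℝ} (hab : a < b) {f : ℝ → E}
    (hf : ∀ h, 0 < h → ContinuousOn (fun t => f (t + h) - f t) (Icc a (b - h))) :
    ∃ H : ℝ → E, (∀ s t, H (s + t) = H s + H t) ∧
      ContinuousOn (fun t => f t - H t) (Icc a b) := by
  have hp : 0 < b - a := sub_pos.2 hab
  obtain ⟨p, rfl⟩ : ∃ p, b = a + p := ⟨b - a, by ring⟩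
  rw [add_sub_cancel_left] at hp
  set c : E := p⁻¹ • (f (a + p) - f a) with hc
  obtain ⟨H, hH, hcont⟩ := exists_additive_continuousOn_sub_of_eq_endpoints (a := a) hp
    (f := fun t => f t - t • c)
    (by
      have : p • c = f (a + p) - f a := by rw [hc, smul_inv_smul₀ hp.ne']
      simp only [add_smul, this]
      abel)
    (fun h h0 => ((hf h h0).sub (continuousOn_const (c := h • c))).congr fun t _ => by
      simp only [add_smul, Pi.sub_apply]
      abel)
  refine ⟨H, hH, ?_⟩
  have h1 : ContinuousOn (fun t : ℝ => t • c) (Icc a (a + p)) := by fun_prop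
  refine (hcont.add h1).congr fun t _ => ?_
  simp only [Pi.add_apply]
  abel

/-- If the differences of `g` are continuous on an interval and `g` is continuous at some
interior point of the interval, then `g` is continuous on it. -/
theorem continuousOn_of_continuousAt_of_difference {E : Type*} [NormedAddCommGroup E]
    {I : Set ℝ} {g : ℝ → E}
    (hg : ∀ h : ℝ, 0 < h → ContinuousOn (fun t => g (t + h) - g t) {t ∈ I | t + h ∈ I})
    {c : ℝ} (hI : I ∈ 𝓝 c) (hc : ContinuousAt g c) : ContinuousOn g I := by
  intro x hx
  have hcI : c ∈ I := mem_of_mem_nhds hI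
  have hshift : Tendsto (fun y => y + (c - x)) (𝓝[I] x) (𝓝 c) := by
    have : Continuous fun y : ℝ => y + (c - x) := by fun_prop
    simpa using (this.tendsto x).mono_left nhdsWithin_le_nhds
  have hgc : Tendsto (fun y => g (y + (c - x))) (𝓝[I] x) (𝓝 (g c)) := hc.tendsto.comp hshift
  have hmem : ∀ᶠ y in 𝓝[I] x, y ∈ I ∧ y + (c - x) ∈ I :=
    (eventually_mem_nhdsWithin).and (hshift hI)
  rcases lt_trichotomy x c with h | rfl | h
  · have h1 := hg (c - x) (sub_pos.2 h) x ⟨hx, by simpa using hcI⟩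
    have h2 : Tendsto id (𝓝[I] x) (𝓝[{t ∈ I | t + (c - x) ∈ I}] x) :=
      tendsto_nhdsWithin_iff.2 ⟨nhdsWithin_le_nhds, hmem⟩
    have h3 := hgc.sub (h1.tendsto.comp h2)
    simpa [Function.comp_def, ContinuousWithinAt] using h3
  · exact hc.continuousWithinAt
  · have h1 := hg (x - c) (sub_pos.2 h) c ⟨hcI, by simpa using hx⟩
    have h2 : Tendsto (fun y => y + (c - x)) (𝓝[I] x) (𝓝[{t ∈ I | t + (x - c) ∈ I}] c) :=
      tendsto_nhdsWithin_iff.2 ⟨hshift, hmem.mono fun y hy => ⟨hy.2, by simpa [add_assoc] using hy.1⟩⟩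
    have h3 := hgc.add (h1.tendsto.comp h2)
    simpa [Function.comp_def, ContinuousWithinAt, add_assoc] using h3

/-- de Bruijn; Corollary 7.5.  Let `I ⊆ ℝ` be an arbitrary interval,
`𝕂 = ℝ` or `ℂ`, and `f : I → 𝕂` arbitrary such that for each `h > 0` the difference
`t ↦ f(t+h) − f(t)` is continuous on `I ∩ (I − h)`.  Then `f = g + H` on `I` with
`g` continuous on `I` and `H : ℝ → 𝕂` additive. -/
theorem cor_7_5 {𝕂 : Type*} [RCLike 𝕂] (I : Set ℝ) (hI : I.OrdConnected)
    (f : ℝ → 𝕂)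
    (hf : ∀ h : ℝ, 0 < h →
      ContinuousOn (fun t => f (t + h) - f t) {t ∈ I | t + h ∈ I}) :
    ∃ g H : ℝ → 𝕂, ContinuousOn g I ∧
      (∀ s t : ℝ, H (s + t) = H s + H t) ∧
      ∀ t ∈ I, f t = g t + H t := by
  rcases I.subsingleton_or_nontrivial with hs | hn
  · exact ⟨f, 0, hs.continuousOn f, by simp, by simp⟩
  obtain ⟨a, ha, b, hb, hab⟩ := hn.exists_lt
  have hsub : Icc a b ⊆ I := hI.out ha hb
  obtain ⟨H, hH, hc⟩ := exists_additive_continuousOn_sub_Icc hab (f := f) fun h h0 =>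
    (hf h h0).mono fun t ht => ⟨hsub ⟨ht.1, by linarith [ht.2]⟩,
      hsub ⟨by linarith [ht.1], by linarith [ht.2]⟩⟩
  refine ⟨fun t => f t - H t, H, ?_, hH, fun t _ => (sub_add_cancel _ _).symm⟩
  have hnhds : Icc a b ∈ 𝓝 ((a + b) / 2) := Icc_mem_nhds (by linarith) (by linarith)
  refine continuousOn_of_continuousAt_of_difference (fun h h0 => ?_)
    (mem_of_superset hnhds hsub) (hc.continuousAt hnhds)
  refine ((hf h h0).sub (continuousOn_const (c := H h))).congr fun t _ => ?_
  simp only [hH, Pi.sub_apply]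
  abel
end

section
/- Let 𝕁 be an interval of the form ℝ, (α,∞) or [α,∞) and X a Banach space. Then each of the four classes ℰ₀(𝕁,X), ℰ_n(𝕁,X), Av₀(𝕁,X) and Av_n(𝕁,X) satisfies condition (Δ): if 𝒜 is one of these classes and φ ∈ L¹_loc(𝕁,X) satisfies Δ_s φ ∈ 𝒜 for all s > 0, then φ − M_h φ ∈ 𝒜 for all h > 0. -/
open MeasureTheory Set

/-- The mean `M_h φ(t) = (1/h) ∫₀^h φ(t+s) ds`. -/
noncomputable def meanM {X : Type*} [NormedAddCommGroup X] [NormedSpace ℝ X]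
    (h : ℝ) (φ : ℝ → X) : ℝ → X :=
  fun t => (1 / h) • ∫ s in (0 : ℝ)..h, φ (t + s)

/-- `a` is the ergodic mean of `φ` on `𝕁`: `sup_{x∈𝕁} ‖M_T φ(x) − a‖ → 0` as `T → ∞`. -/
noncomputable def IsErgodicMean {X : Type*} [NormedAddCommGroup X] [NormedSpace ℝ X]
    (J : Set ℝ) (φ : ℝ → X) (a : X) : Prop :=
  ∀ ε : ℝ, 0 < ε → ∃ T₀ : ℝ, ∀ T ≥ T₀, ∀ x ∈ J, ‖meanM T φ x - a‖ ≤ ε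

/-- The ergodic class `ℰ(𝕁,X)`. -/
noncomputable def ergE {X : Type*} [NormedAddCommGroup X] [NormedSpace ℝ X]
    (J : Set ℝ) : Set (ℝ → X) :=
  {φ | LocallyIntegrableOn φ J ∧ ∃ a : X, IsErgodicMean J φ a}

/-- `ℰ₀(𝕁,X)`: ergodic functions with mean `0`. -/
noncomputable def ergE0 {X : Type*} [NormedAddCommGroup X] [NormedSpace ℝ X]
    (J : Set ℝ) : Set (ℝ → X) :=
  {φ | LocallyIntegrableOn φ J ∧ IsErgodicMean J φ 0}

/-- `ℰ_n(𝕁,X)`: ergodic null functions, `f ∈ ℰ` with `‖f(·)‖ ∈ ℰ₀(𝕁,ℝ)`. -/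
noncomputable def ergEnull {X : Type*} [NormedAddCommGroup X] [NormedSpace ℝ X]
    (J : Set ℝ) : Set (ℝ → X) :=
  {φ | φ ∈ ergE J ∧ (fun t => ‖φ t‖) ∈ ergE0 (X := ℝ) J}

/-- `Av₀(𝕁,X) = {f ∈ L¹_loc : (1/T)∫_{α₀}^{α₀+T} f(t) dt → 0 as T → ∞}`. -/
noncomputable def Av0 {X : Type*} [NormedAddCommGroup X] [NormedSpace ℝ X]
    (J : Set ℝ) (α₀ : ℝ) : Set (ℝ → X) :=
  {f | LocallyIntegrableOn f J ∧ ∀ ε : ℝ, 0 < ε → ∃ T₀ : ℝ, ∀ T ≥ T₀,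
    ‖(1 / T) • ∫ t in α₀..(α₀ + T), f t‖ ≤ ε}

/-- `Av_n(𝕁,X) = {f ∈ L¹_loc : (1/T)∫_{α₀}^{α₀+T} ‖f(t)‖ dt → 0 as T → ∞}`. -/
noncomputable def Avnull {X : Type*} [NormedAddCommGroup X]
    (J : Set ℝ) (α₀ : ℝ) : Set (ℝ → X) :=
  {f | LocallyIntegrableOn f J ∧ ∀ ε : ℝ, 0 < ε → ∃ T₀ : ℝ, ∀ T ≥ T₀,
    (1 / T) * ∫ t in α₀..(α₀ + T), ‖f t‖ ≤ ε}

/-- Condition (Δ) for a class `𝒜 ⊆ L¹_loc(𝕁,X)`. -/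
def deltaCond {X : Type*} [NormedAddCommGroup X] [NormedSpace ℝ X]
    (J : Set ℝ) (A : Set (ℝ → X)) : Prop :=
  ∀ φ : ℝ → X, LocallyIntegrableOn φ J →
    (∀ s : ℝ, 0 < s → (fun t => φ (t + s) - φ t) ∈ A) →
    ∀ h : ℝ, 0 < h → (fun t => φ t - meanM h φ t) ∈ A

/-- `φ` is integrable on every compact interval `[x, b]`. -/
def IntegrableFrom {X : Type*} [NormedAddCommGroup X] (φ : ℝ → X) (x : ℝ) : Prop :=
  ∀ b : ℝ, IntegrableOn φ (Icc x b)

namespace IntegrableFrom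

variable {X : Type*} [NormedAddCommGroup X] {φ ψ : ℝ → X} {x y a b s : ℝ}

theorem mono (hφ : IntegrableFrom φ x) (hxy : x ≤ y) : IntegrableFrom φ y := fun b =>
  (hφ b).mono_set (Icc_subset_Icc_left hxy)

theorem intervalIntegrable (hφ : IntegrableFrom φ x) (ha : x ≤ a) (hb : x ≤ b) :
    IntervalIntegrable φ volume a b := by
  rw [intervalIntegrable_iff]
  refine (hφ (max a b)).mono_set ?_
  intro t ht
  exact ⟨(le_min ha hb).trans ht.1.le, ht.2⟩

theorem sub (hφ : IntegrableFrom φ x) (hψ : IntegrableFrom ψ x) :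
    IntegrableFrom (fun t => φ t - ψ t) x := fun b => (hφ b).sub (hψ b)

theorem norm (hφ : IntegrableFrom φ x) : IntegrableFrom (fun t => ‖φ t‖) x :=
  fun b => (hφ b).norm

theorem comp_add_right (hφ : IntegrableFrom φ x) (hs : 0 ≤ s) :
    IntegrableFrom (fun t => φ (t + s)) x := fun b => by
  have h := (hφ.mono (le_add_of_nonneg_right hs)) (b + s)
  have e : (fun t => t + s) ⁻¹' Icc (x + s) (b + s) = Icc x b := by
    ext t; simp
  rw [← e]
  exact ((measurePreserving_add_right volume s).integrableOn_comp_preimage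
    (measurableEmbedding_addRight s)).2 h

theorem integrable_indicator (hφ : IntegrableFrom φ x) (b : ℝ) :
    Integrable ((Icc x b).indicator φ) :=
  (hφ b).integrable_indicator measurableSet_Icc

end IntegrableFrom

/-- Translation is continuous in `L¹(ℝ, X)`. -/
theorem tendsto_integral_norm_translate_sub {X : Type*} [NormedAddCommGroup X]
    {ψ : ℝ → X} (hψ : Integrable ψ) (r : ℝ) :
    Filter.Tendsto (fun s => ∫ t, ‖ψ (t + s) - ψ (t + r)‖) (nhds r) (nhds 0) := by
  have hm := memLp_one_iff_integrable.2 hψ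
  have hc : Continuous fun s : ℝ => (DomAddAct.mk s) +ᵥ hm.toLp ψ := by
    have : Fact ((1 : ENNReal) ≠ ⊤) := ⟨ENNReal.one_ne_top⟩
    have h1 : Continuous fun s : ℝ => DomAddAct.mk s := DomAddAct.continuous_mk
    exact h1.vadd continuous_const
  have ht := tendsto_iff_norm_sub_tendsto_zero.1 (hc.tendsto r)
  refine ht.congr fun s => ?_
  rw [DomAddAct.mk_vadd_toLp, DomAddAct.mk_vadd_toLp, ← MemLp.toLp_sub, L1.norm_eq_integral_norm]
  refine integral_congr_ae ?_
  filter_upwards [MemLp.coeFn_toLp ((hm.comp_measurePreserving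
    (measurePreserving_vadd s volume)).sub
    (hm.comp_measurePreserving (measurePreserving_vadd r volume)))] with t h
  refine (congrArg norm h).trans ?_
  simp [add_comm]

/-- Translation is continuous in `L¹([x, x + T], X)`. -/
theorem IntegrableFrom.tendsto_translate {X : Type*} [NormedAddCommGroup X] {φ : ℝ → X} {x : ℝ}
    (hφ : IntegrableFrom φ x) {T r : ℝ} (hT : 0 ≤ T) (hr : 0 ≤ r) :
    Filter.Tendsto (fun s => ∫ t in x..x + T, ‖φ (t + s) - φ (t + r)‖)
      (nhdsWithin r (Ici 0)) (nhds 0) := by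
  have hi := hφ.integrable_indicator (x + T + r + 1)
  have h := (tendsto_integral_norm_translate_sub hi r).mono_left
    (nhdsWithin_le_nhds (s := Ici 0))
  refine squeeze_zero' (Filter.Eventually.of_forall fun s =>
    intervalIntegral.integral_nonneg (by linarith) fun t _ => norm_nonneg _) ?_ h
  have hlt : ∀ᶠ s in nhdsWithin r (Ici (0 : ℝ)), s < r + 1 :=
    nhdsWithin_le_nhds (Iio_mem_nhds (by linarith))
  filter_upwards [hlt, self_mem_nhdsWithin] with s hs1 hs0
  rw [intervalIntegral.integral_of_le (by linarith)]
  have e : ∀ t ∈ Ioc x (x + T), ∀ u, 0 ≤ u → u ≤ r + 1 →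
      (Icc x (x + T + r + 1)).indicator φ (t + u) = φ (t + u) := fun t ht u h0 h1 =>
    indicator_of_mem (by constructor <;> linarith [ht.1, ht.2]) φ
  calc ∫ t in Ioc x (x + T), ‖φ (t + s) - φ (t + r)‖
      = ∫ t in Ioc x (x + T), ‖(Icc x (x + T + r + 1)).indicator φ (t + s)
          - (Icc x (x + T + r + 1)).indicator φ (t + r)‖ := by
        refine setIntegral_congr_fun measurableSet_Ioc fun t ht => ?_
        simp only [e t ht s hs0 hs1.le, e t ht r hr (by linarith)]
    _ ≤ _ := setIntegral_le_integral ((hi.comp_add_right s).sub (hi.comp_add_right r)).norm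
        (Filter.Eventually.of_forall fun t => norm_nonneg _)

theorem meanM_norm_nonneg {X : Type*} [NormedAddCommGroup X] {φ : ℝ → X} {x T : ℝ}
    (hT : 0 < T) : 0 ≤ meanM T (fun t => ‖φ t‖) x :=
  smul_nonneg (by positivity) (intervalIntegral.integral_nonneg hT.le fun _ _ => norm_nonneg _)

theorem IntegrableFrom.integrable_prod {X : Type*} [NormedAddCommGroup X] {φ : ℝ → X}
    {x : ℝ} (hφ : IntegrableFrom φ x) (T h : ℝ) :
    Integrable (fun p : ℝ × ℝ => φ (p.1 + p.2) - φ p.1)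
      ((volume.restrict (Ioc x (x + T))).prod (volume.restrict (Ioc 0 h))) := by
  have hi := hφ.integrable_indicator (x + T + h)
  have h1 : Integrable (fun p : ℝ × ℝ => (Icc x (x + T + h)).indicator φ (p.1 + p.2))
      ((volume.restrict (Ioc x (x + T))).prod (volume.restrict (Ioc 0 h))) := by
    have h2 := hi.comp_snd (volume.restrict (Ioc x (x + T)))
    have h3 := (measurePreserving_prod_add (volume.restrict (Ioc x (x + T)))
      (volume : Measure ℝ)).integrable_comp_of_integrable h2
    refine h3.mono_measure ?_
    exact Measure.prod_mono le_rfl Measure.restrict_le_self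
  have h4 : Integrable (fun p : ℝ × ℝ => φ p.1)
      ((volume.restrict (Ioc x (x + T))).prod (volume.restrict (Ioc 0 h))) :=
    Integrable.comp_fst ((hφ (x + T)).mono_set Ioc_subset_Icc_self) _
  refine Integrable.sub (h1.congr ?_) h4
  rw [Measure.prod_restrict]
  filter_upwards [ae_restrict_mem (measurableSet_Ioc.prod measurableSet_Ioc)] with p hp
  exact indicator_of_mem (by constructor <;> linarith [hp.1.1, hp.1.2, hp.2.1, hp.2.2]) φ

section Mean

variable {X : Type*} [NormedAddCommGroup X] [NormedSpace ℝ X] {φ : ℝ → X} {x T h : ℝ}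

theorem meanM_eq (T : ℝ) (φ : ℝ → X) (x : ℝ) :
    meanM T φ x = (1 / T) • ∫ t in x..x + T, φ t := by
  simp [meanM]

theorem norm_meanM_le (hT : 0 < T) : ‖meanM T φ x‖ ≤ meanM T (fun t => ‖φ t‖) x := by
  rw [meanM, meanM, norm_smul, Real.norm_of_nonneg (by positivity), smul_eq_mul]
  gcongr
  exact intervalIntegral.norm_integral_le_integral_norm hT.le

theorem meanM_congr {ψ : ℝ → X} (hT : 0 ≤ T) (he : ∀ t, x ≤ t → φ t = ψ t) :
    meanM T φ x = meanM T ψ x := by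
  rw [meanM_eq, meanM_eq]
  congr 1
  refine intervalIntegral.integral_congr fun t ht => he t ?_
  rw [uIcc_of_le (by linarith)] at ht
  exact ht.1

theorem meanM_sub {ψ : ℝ → X} (hφ : IntegrableFrom φ x) (hψ : IntegrableFrom ψ x) (hT : 0 ≤ T) :
    meanM T (fun t => φ t - ψ t) x = meanM T φ x - meanM T ψ x := by
  rw [meanM_eq, meanM_eq, meanM_eq, intervalIntegral.integral_sub, smul_sub]
  exacts [hφ.intervalIntegrable le_rfl (by linarith), hψ.intervalIntegrable le_rfl (by linarith)]

theorem meanM_comp_add (T : ℝ) (φ : ℝ → X) (x s : ℝ) :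
    meanM T (fun t => φ (t + s)) x = meanM T φ (x + s) := by
  simp only [meanM, add_right_comm]

theorem IntegrableFrom.meanM (hφ : IntegrableFrom φ x) (hh : 0 ≤ h) :
    IntegrableFrom (meanM h φ) x := fun b => by
  have hi := hφ.integrable_indicator (b + h)
  set ψ := (Icc x (b + h)).indicator φ
  have hc : Continuous (_root_.meanM h ψ) := by
    have hF := intervalIntegral.continuous_primitive
      (fun a b => hi.intervalIntegrable (a := a) (b := b)) 0
    have e : _root_.meanM h ψ =
        fun t => (1 / h) • ((∫ u in (0 : ℝ)..t + h, ψ u) - ∫ u in (0 : ℝ)..t, ψ u) := by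
      funext t
      rw [meanM_eq, intervalIntegral.integral_interval_sub_left hi.intervalIntegrable
        hi.intervalIntegrable]
    rw [e]
    exact ((hF.comp (continuous_id.add continuous_const)).sub hF).const_smul _
  refine (hc.continuousOn.integrableOn_compact isCompact_Icc).congr_fun ?_ measurableSet_Icc
  intro t ht
  rw [meanM_eq, meanM_eq]
  congr 1
  refine intervalIntegral.integral_congr fun u hu => ?_
  rw [uIcc_of_le (by linarith)] at hu
  exact indicator_of_mem (s := Icc x (b + h)) ⟨ht.1.trans hu.1, by linarith [hu.2, ht.2]⟩ φ

theorem sub_meanM_eq [CompleteSpace X] (hφ : IntegrableFrom φ x) (hh : 0 < h) :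
    φ x - meanM h φ x = -((1 / h) • ∫ s in (0 : ℝ)..h, (φ (x + s) - φ x)) := by
  have hi : IntervalIntegrable (fun s => φ (x + s)) volume 0 h := by
    have := (hφ.intervalIntegrable (a := x) (b := x + h) le_rfl (by linarith)).comp_add_left x
    simpa using this
  rw [intervalIntegral.integral_sub hi (by simp), intervalIntegral.integral_const, smul_sub,
    smul_smul]
  simp [meanM, hh.ne']

end Mean

/-- A Baire category argument: a family of functions on `[0, ∞)` that tends to `0` pointwise in
`s`, and whose translation increments tend to `0` locally uniformly, tends to `0` locally
uniformly in `s`. -/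
theorem exists_forall_le_of_forall_exists_le {I : Set ℝ} {K : ℝ → ℝ → ℝ → ℝ}
    (hc : ∀ T, 1 ≤ T → ∀ x ∈ I, ContinuousOn (K T x) (Ici 0))
    (h0 : ∀ s, 0 < s → ∀ ε, 0 < ε → ∃ T₀, ∀ T ≥ T₀, ∀ x ∈ I, K T x s ≤ ε)
    (hd : ∀ a, 0 < a → ∀ c, ∀ ε, 0 < ε → ∃ T₀, ∀ T ≥ T₀, ∀ x ∈ I, ∀ s ∈ Icc 0 c,
      |K T x (s + a) - K T x s| ≤ ε)
    (h : ℝ) {ε : ℝ} (hε : 0 < ε) :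
    ∃ T₀, ∀ T ≥ T₀, ∀ x ∈ I, ∀ s ∈ Icc 0 h, K T x s ≤ ε := by
  obtain ⟨n, u, hu⟩ : ∃ n : ℕ,
      (interior {u : ℝ | ∀ T, 1 ≤ T → (n : ℝ) ≤ T → ∀ x ∈ I, K T x (Real.exp u) ≤ ε / 3}).Nonempty
      := by
    refine nonempty_interior_of_iUnion_of_closed (fun n => ?_) (eq_univ_of_forall fun u => ?_)
    · simp only [ofPred_forall]
      refine isClosed_iInter fun T => isClosed_iInter fun hT => isClosed_iInter fun _ =>
        isClosed_iInter fun x => isClosed_iInter fun hx => ?_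
      refine isClosed_le ?_ continuous_const
      exact (hc T hT x hx).comp_continuous Real.continuous_exp fun u => (Real.exp_pos u).le
    · obtain ⟨T₀, hT₀⟩ := h0 _ (Real.exp_pos u) (ε / 3) (by positivity)
      obtain ⟨n, hn⟩ := exists_nat_ge T₀
      exact mem_iUnion.2 ⟨n, fun T _ hT x hx => hT₀ T (hn.trans hT) x hx⟩
  obtain ⟨r, hr, hball⟩ := Metric.isOpen_iff.1 isOpen_interior u hu
  set a := Real.exp u with ha
  set δ := Real.exp (u + r / 2) - a with hδ
  have ha0 : 0 < a := Real.exp_pos u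
  have hδ0 : 0 < δ := sub_pos.2 (Real.exp_lt_exp.2 (by linarith))
  have hsmall : ∀ T, 1 ≤ T → (n : ℝ) ≤ T → ∀ x ∈ I, ∀ s ∈ Icc 0 δ, K T x (s + a) ≤ ε / 3 := by
    intro T hT1 hTn x hx s hs
    have hpos : 0 < s + a := by linarith [hs.1]
    have hmem : Real.log (s + a) ∈ Metric.ball u r := by
      rw [Metric.mem_ball, Real.dist_eq, abs_lt]
      have h1 : u ≤ Real.log (s + a) := (Real.le_log_iff_exp_le hpos).2 (by linarith [hs.1])
      have h2 : Real.log (s + a) ≤ u + r / 2 :=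
        (Real.log_le_iff_le_exp hpos).2 (by linarith [hs.2])
      constructor <;> linarith
    have := interior_subset (hball hmem) T hT1 hTn x hx
    rwa [Real.exp_log hpos] at this
  have hbase : ∃ T₀, ∀ T ≥ T₀, ∀ x ∈ I, ∀ s ∈ Icc 0 δ, K T x s ≤ 2 * (ε / 3) := by
    obtain ⟨T₁, hT₁⟩ := hd a ha0 δ (ε / 3) (by positivity)
    refine ⟨max T₁ (max 1 n), fun T hT x hx s hs => ?_⟩
    simp only [ge_iff_le, max_le_iff] at hT
    linarith [(abs_le.1 (hT₁ T hT.1 x hx s hs)).1, hsmall T hT.2.1 hT.2.2 x hx s hs]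
  have hstep : ∀ k : ℕ, ∃ T₀, ∀ T ≥ T₀, ∀ x ∈ I, ∀ s ∈ Icc 0 ((k + 1) * δ), K T x s ≤ ε := by
    intro k
    induction k with
    | zero =>
      obtain ⟨T₁, hT₁⟩ := hbase
      exact ⟨T₁, fun T hT x hx s hs =>
        (hT₁ T hT x hx s ⟨hs.1, by simpa using hs.2⟩).trans (by linarith)⟩
    | succ k ih =>
      obtain ⟨T₁, hT₁⟩ := ih
      obtain ⟨T₂, hT₂⟩ := hbase
      have hp : 0 < ((k : ℝ) + 1) * δ := by positivity
      obtain ⟨T₃, hT₃⟩ := hd _ hp δ (ε / 3) (by positivity)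
      refine ⟨max T₁ (max T₂ T₃), fun T hT x hx s hs => ?_⟩
      simp only [ge_iff_le, max_le_iff] at hT
      rcases le_or_gt s ((k + 1) * δ) with hsk | hsk
      · exact hT₁ T hT.1 x hx s ⟨hs.1, hsk⟩
      · have hs' : s - (k + 1) * δ ∈ Icc 0 δ := by
          have := hs.2
          push_cast at this
          constructor <;> linarith
        have h3 := (abs_le.1 (hT₃ T hT.2.2 x hx _ hs')).2
        rw [sub_add_cancel] at h3
        linarith [hT₂ T hT.2.1 x hx _ hs']
  obtain ⟨k, hk⟩ := exists_nat_ge (h / δ)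
  obtain ⟨T₀, hT₀⟩ := hstep k
  refine ⟨T₀, fun T hT x hx s hs => hT₀ T hT x hx s ⟨hs.1, hs.2.trans ?_⟩⟩
  rw [div_le_iff₀ hδ0] at hk
  linarith

/-- The means `M_T f(x + s)` tend to `0` as `T → ∞`, uniformly for `x ∈ I` and locally uniformly
for `s ≥ 0`. -/
def UniformlyNullOnShifts {X : Type*} [NormedAddCommGroup X] [NormedSpace ℝ X]
    (I : Set ℝ) (f : ℝ → X) : Prop :=
  ∀ c ε : ℝ, 0 < ε → ∃ T₀ : ℝ, ∀ T ≥ T₀, ∀ x ∈ I, ∀ s ∈ Icc 0 c, ‖meanM T f (x + s)‖ ≤ ε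

section Differences

variable {X : Type*} [NormedAddCommGroup X] [NormedSpace ℝ X] {φ f : ℝ → X} {I J : Set ℝ}
  {x T h ε : ℝ}

theorem UniformlyNullOnShifts.exists_forall_norm_le (hf : UniformlyNullOnShifts I f)
    (hε : 0 < ε) : ∃ T₀ : ℝ, ∀ T ≥ T₀, ∀ x ∈ I, ‖meanM T f x‖ ≤ ε := by
  obtain ⟨T₀, hT₀⟩ := hf 0 ε hε
  exact ⟨T₀, fun T hT x hx => by simpa using hT₀ T hT x hx 0 (by simp)⟩

theorem norm_meanM_sub_meanM_comp_le (hφ : IntegrableFrom φ x) (hT : 0 < T) {s r : ℝ}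
    (hs : 0 ≤ s) (hr : 0 ≤ r) :
    ‖meanM T (fun t => φ (t + s) - φ t) x - meanM T (fun t => φ (t + r) - φ t) x‖
      ≤ (1 / T) * ∫ t in x..x + T, ‖φ (t + s) - φ (t + r)‖ := by
  rw [← meanM_sub ((hφ.comp_add_right hs).sub hφ) ((hφ.comp_add_right hr).sub hφ) hT.le]
  refine (norm_meanM_le hT).trans_eq ?_
  rw [meanM_eq, smul_eq_mul]
  simp only [sub_sub_sub_cancel_right]

theorem abs_meanM_norm_sub_le {X : Type*} [NormedAddCommGroup X] {φ : ℝ → X} {x T : ℝ}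
    (hφ : IntegrableFrom φ x) (hT : 0 < T) {s r : ℝ} (hs : 0 ≤ s) (hr : 0 ≤ r) :
    |meanM T (fun t => ‖φ (t + s) - φ t‖) x - meanM T (fun t => ‖φ (t + r) - φ t‖) x|
      ≤ meanM T (fun t => ‖φ (t + s) - φ (t + r)‖) x := by
  have h1 := (hφ.comp_add_right hs).sub hφ
  have h2 := (hφ.comp_add_right hr).sub hφ
  rw [← meanM_sub h1.norm h2.norm hT.le, ← Real.norm_eq_abs]
  refine (norm_meanM_le hT).trans ?_
  rw [meanM_eq, meanM_eq, smul_eq_mul, smul_eq_mul]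
  gcongr
  refine intervalIntegral.integral_mono_on (by linarith)
    ((h1.norm.sub h2.norm).norm.intervalIntegrable le_rfl (by linarith))
    (((hφ.comp_add_right hs).sub (hφ.comp_add_right hr)).norm.intervalIntegrable le_rfl
      (by linarith)) fun t _ => ?_
  rw [Real.norm_eq_abs]
  refine (abs_norm_sub_norm_le _ _).trans_eq ?_
  rw [sub_sub_sub_cancel_right]

theorem continuousOn_meanM_sub (hφ : IntegrableFrom φ x) (hT : 0 < T) :
    ContinuousOn (fun s => meanM T (fun t => φ (t + s) - φ t) x) (Ici 0) := by
  intro r hr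
  refine tendsto_iff_norm_sub_tendsto_zero.2 ?_
  have hlim := (hφ.tendsto_translate hT.le hr).const_mul (1 / T)
  rw [mul_zero] at hlim
  refine squeeze_zero' (Filter.Eventually.of_forall fun s => norm_nonneg _) ?_ hlim
  filter_upwards [self_mem_nhdsWithin] with s hs
  exact norm_meanM_sub_meanM_comp_le hφ hT hs hr

theorem continuousOn_meanM_norm_sub {X : Type*} [NormedAddCommGroup X] {φ : ℝ → X} {x T : ℝ}
    (hφ : IntegrableFrom φ x) (hT : 0 < T) :
    ContinuousOn (fun s => meanM T (fun t => ‖φ (t + s) - φ t‖) x) (Ici 0) := by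
  intro r hr
  refine tendsto_iff_norm_sub_tendsto_zero.2 ?_
  have hlim := (hφ.tendsto_translate hT.le hr).const_mul (1 / T)
  rw [mul_zero] at hlim
  refine squeeze_zero' (Filter.Eventually.of_forall fun s => norm_nonneg _) ?_ hlim
  filter_upwards [self_mem_nhdsWithin] with s hs
  refine (abs_meanM_norm_sub_le hφ hT hs hr).trans_eq ?_
  rw [meanM_eq, smul_eq_mul]

theorem norm_meanM_sub_meanM_le [CompleteSpace X] (hφ : IntegrableFrom φ x) (hT : 0 < T)
    (hh : 0 < h) (hb : ∀ s ∈ Icc 0 h, ‖meanM T (fun t => φ (t + s) - φ t) x‖ ≤ ε) :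
    ‖meanM T (fun t => φ t - meanM h φ t) x‖ ≤ ε := by
  have key : meanM T (fun t => φ t - meanM h φ t) x
      = -((1 / h) • ∫ s in (0 : ℝ)..h, meanM T (fun t => φ (t + s) - φ t) x) := by
    rw [meanM_congr hT.le fun t ht => sub_meanM_eq (hφ.mono ht) hh]
    simp only [meanM_eq T]
    rw [intervalIntegral.integral_neg, intervalIntegral.integral_smul,
      intervalIntegral.integral_smul, smul_neg, smul_comm]
    congr 3
    simp only [intervalIntegral.integral_of_le hh.le,
      intervalIntegral.integral_of_le (le_add_of_nonneg_right hT.le : x ≤ x + T)]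
    exact integral_integral_swap (hφ.integrable_prod T h)
  rw [key, norm_neg, norm_smul, Real.norm_of_nonneg (by positivity)]
  have := intervalIntegral.norm_integral_le_of_norm_le_const (a := 0) (b := h) (C := ε)
    (f := fun s => meanM T (fun t => φ (t + s) - φ t) x) fun s hs => by
      rw [uIoc_of_le hh.le] at hs
      exact hb s (Ioc_subset_Icc_self hs)
  rw [sub_zero, abs_of_pos hh] at this
  calc (1 / h) * _ ≤ (1 / h) * (ε * h) := by gcongr
    _ = ε := by field_simp

theorem meanM_norm_sub_meanM_le [CompleteSpace X] (hφ : IntegrableFrom φ x) (hT : 0 < T)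
    (hh : 0 < h) (hb : ∀ s ∈ Icc 0 h, meanM T (fun t => ‖φ (t + s) - φ t‖) x ≤ ε) :
    meanM T (fun t => ‖φ t - meanM h φ t‖) x ≤ ε := by
  have hxT : x ≤ x + T := le_add_of_nonneg_right hT.le
  have hprod := (hφ.integrable_prod T h).norm
  have hpt : ∀ t, x ≤ t →
      ‖φ t - meanM h φ t‖ ≤ (1 / h) * ∫ s in (0 : ℝ)..h, ‖φ (t + s) - φ t‖ := fun t ht => by
    rw [sub_meanM_eq (hφ.mono ht) hh, norm_neg, norm_smul, Real.norm_of_nonneg (by positivity)]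
    gcongr
    exact intervalIntegral.norm_integral_le_integral_norm hh.le
  have hint : IntervalIntegrable (fun t => (1 / h) * ∫ s in (0 : ℝ)..h, ‖φ (t + s) - φ t‖)
      volume x (x + T) := by
    rw [intervalIntegrable_iff_integrableOn_Ioc_of_le hxT]
    simp only [intervalIntegral.integral_of_le hh.le]
    exact hprod.integral_prod_left.const_mul _
  calc meanM T (fun t => ‖φ t - meanM h φ t‖) x
      ≤ (1 / T) * ∫ t in x..x + T, (1 / h) * ∫ s in (0 : ℝ)..h, ‖φ (t + s) - φ t‖ := by
        rw [meanM_eq, smul_eq_mul]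
        gcongr
        exact intervalIntegral.integral_mono_on hxT
          ((hφ.sub (hφ.meanM hh.le)).norm.intervalIntegrable le_rfl hxT) hint
          fun t ht => hpt t ht.1
    _ = (1 / h) * ∫ s in (0 : ℝ)..h, meanM T (fun t => ‖φ (t + s) - φ t‖) x := by
        simp only [meanM_eq T, smul_eq_mul, intervalIntegral.integral_const_mul]
        rw [mul_left_comm]
        congr 2
        simp only [intervalIntegral.integral_of_le hh.le, intervalIntegral.integral_of_le hxT]
        exact integral_integral_swap hprod
    _ ≤ (1 / h) * ∫ s in (0 : ℝ)..h, ε := by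
        gcongr
        refine intervalIntegral.integral_mono_on hh.le ?_ (by simp) hb
        refine ((continuousOn_meanM_norm_sub hφ hT).mono ?_).intervalIntegrable
        rw [uIcc_of_le hh.le]
        exact Icc_subset_Ici_self
    _ = ε := by
        rw [intervalIntegral.integral_const, smul_eq_mul]
        field_simp
        ring

theorem isErgodicMean_sub_meanM [CompleteSpace X] (hφ : ∀ x ∈ I, IntegrableFrom φ x)
    (hΔ : ∀ s, 0 < s → UniformlyNullOnShifts I fun t => φ (t + s) - φ t) (hh : 0 < h) :
    IsErgodicMean I (fun t => φ t - meanM h φ t) 0 := by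
  intro ε hε
  obtain ⟨T₀, hT₀⟩ := exists_forall_le_of_forall_exists_le
    (K := fun T x s => ‖meanM T (fun t => φ (t + s) - φ t) x‖)
    (fun T hT x hx => (continuousOn_meanM_sub (hφ x hx) (by linarith)).norm)
    (fun s hs ε hε => (hΔ s hs).exists_forall_norm_le hε)
    (fun a ha c ε hε => by
      obtain ⟨T₁, hT₁⟩ := hΔ a ha c ε hε
      refine ⟨max T₁ 1, fun T hT x hx s hs => ?_⟩
      simp only [ge_iff_le, max_le_iff] at hT
      have hT0 : 0 < T := by linarith
      refine (abs_norm_sub_norm_le _ _).trans ?_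
      have hsa : 0 ≤ s + a := by linarith [hs.1]
      rw [← meanM_sub (((hφ x hx).comp_add_right hsa).sub (hφ x hx))
        (((hφ x hx).comp_add_right hs.1).sub (hφ x hx)) hT0.le]
      refine le_of_eq_of_le ?_ (hT₁ T hT.1 x hx s hs)
      rw [← meanM_comp_add]
      simp only [sub_sub_sub_cancel_right, add_assoc]) h hε
  refine ⟨max T₀ 1, fun T hT x hx => ?_⟩
  simp only [ge_iff_le, max_le_iff] at hT
  rw [sub_zero]
  exact norm_meanM_sub_meanM_le (hφ x hx) (by linarith) hh (hT₀ T hT.1 x hx)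

theorem isErgodicMean_norm_sub_meanM [CompleteSpace X] (hφ : ∀ x ∈ I, IntegrableFrom φ x)
    (hΔ : ∀ s, 0 < s → UniformlyNullOnShifts I fun t => ‖φ (t + s) - φ t‖) (hh : 0 < h) :
    IsErgodicMean I (fun t => ‖φ t - meanM h φ t‖) 0 := by
  intro ε hε
  obtain ⟨T₀, hT₀⟩ := exists_forall_le_of_forall_exists_le
    (K := fun T x s => meanM T (fun t => ‖φ (t + s) - φ t‖) x)
    (fun T hT x hx => continuousOn_meanM_norm_sub (hφ x hx) (by linarith))
    (fun s hs ε hε => by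
      obtain ⟨T₁, hT₁⟩ := (hΔ s hs).exists_forall_norm_le hε
      exact ⟨T₁, fun T hT x hx => (Real.le_norm_self _).trans (hT₁ T hT x hx)⟩)
    (fun a ha c ε hε => by
      obtain ⟨T₁, hT₁⟩ := hΔ a ha c ε hε
      refine ⟨max T₁ 1, fun T hT x hx s hs => ?_⟩
      simp only [ge_iff_le, max_le_iff] at hT
      have hsa : 0 ≤ s + a := by linarith [hs.1]
      refine (abs_meanM_norm_sub_le (hφ x hx) (by linarith) hsa hs.1).trans ?_
      refine le_of_eq_of_le ?_ ((Real.le_norm_self _).trans (hT₁ T hT.1 x hx s hs))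
      rw [← meanM_comp_add]
      simp only [add_assoc]) h hε
  refine ⟨max T₀ 1, fun T hT x hx => ?_⟩
  simp only [ge_iff_le, max_le_iff] at hT
  have hT0 : 0 < T := by linarith
  rw [sub_zero, Real.norm_of_nonneg (meanM_norm_nonneg hT0)]
  exact meanM_norm_sub_meanM_le (hφ x hx) hT0 hh (hT₀ T hT.1 x hx)

theorem IsErgodicMean.uniformlyNullOnShifts (hJ : ∀ x ∈ J, Ici x ⊆ J)
    (hf : IsErgodicMean J f 0) : UniformlyNullOnShifts J f := fun c ε hε => by
  obtain ⟨T₀, hT₀⟩ := hf ε hε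
  refine ⟨T₀, fun T hT x hx s hs => ?_⟩
  simpa using hT₀ T hT (x + s) (hJ x hx (le_add_of_nonneg_right hs.1))

theorem IsErgodicMean.uniformlyNullOnShifts_singleton (hx : IntegrableFrom f x)
    (hf : IsErgodicMean {x} f 0) : UniformlyNullOnShifts {x} f := by
  intro c ε hε
  obtain ⟨T₀, hT₀⟩ := hf (ε / 4) (by positivity)
  set C := ∫ t in x..x + c, ‖f t‖
  refine ⟨max (max T₀ c) (max 1 (2 * C / ε)), ?_⟩
  rintro T hT y hy s ⟨hs0, hsc⟩
  rw [mem_singleton_iff.1 hy]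
  simp only [ge_iff_le, max_le_iff] at hT
  obtain ⟨⟨hT1, hT2⟩, hT3, hT4⟩ := hT
  have hT0 : 0 < T := by linarith
  have hxs := hx.intervalIntegrable (a := x) (b := x + s) le_rfl (by linarith)
  have hxsT := hx.intervalIntegrable (a := x) (b := x + (s + T)) le_rfl (by linarith)
  have h1 : ‖∫ t in x..x + (s + T), f t‖ ≤ (s + T) * (ε / 4) := by
    have h := hT₀ (s + T) (by linarith) x rfl
    rwa [sub_zero, meanM_eq, norm_smul, Real.norm_of_nonneg (by positivity), one_div,
      inv_mul_le_iff₀ (by linarith)] at h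
  have h2 : ‖∫ t in x..x + s, f t‖ ≤ C := by
    refine (intervalIntegral.norm_integral_le_integral_norm (by linarith)).trans ?_
    exact intervalIntegral.integral_mono_interval le_rfl (by linarith) (by linarith)
      (Filter.Eventually.of_forall fun t => norm_nonneg _)
      (hx.norm.intervalIntegrable le_rfl (by linarith))
  have h3 : C ≤ T * (ε / 2) := by
    rw [div_le_iff₀ hε] at hT4
    linarith
  rw [meanM_eq, norm_smul, Real.norm_of_nonneg (by positivity), one_div,
    inv_mul_le_iff₀ hT0, add_assoc, ← intervalIntegral.integral_interval_sub_left hxsT hxs]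
  refine (norm_sub_le _ _).trans ?_
  have h4 : s * (ε / 4) ≤ T * (ε / 4) := by gcongr; linarith
  linarith

theorem IsErgodicMean.of_norm (hf : IsErgodicMean I (fun t => ‖f t‖) 0) :
    IsErgodicMean I f 0 := fun ε hε => by
  obtain ⟨T₀, hT₀⟩ := hf ε hε
  refine ⟨max T₀ 1, fun T hT x hx => ?_⟩
  simp only [ge_iff_le, max_le_iff] at hT
  have h := hT₀ T hT.1 x hx
  rw [sub_zero] at h ⊢
  exact (norm_meanM_le (by linarith)).trans ((Real.le_norm_self _).trans h)

end Differences

section Interval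

variable {X : Type*} [NormedAddCommGroup X] {φ : ℝ → X} {J : Set ℝ} {x α₀ : ℝ}

theorem MeasureTheory.LocallyIntegrableOn.integrableFrom (hφ : LocallyIntegrableOn φ J)
    (hJ : Ici x ⊆ J) : IntegrableFrom φ x := fun _ =>
  hφ.integrableOn_compact_subset (Icc_subset_Ici_self.trans hJ) isCompact_Icc

theorem locallyIntegrableOn_of_integrableFrom (hJ : IsLocallyClosed J)
    (hφ : ∀ x ∈ J, IntegrableFrom φ x) : LocallyIntegrableOn φ J := by
  refine (locallyIntegrableOn_iff hJ).2 fun k hkJ hk => ?_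
  rcases k.eq_empty_or_nonempty with rfl | hne
  · exact integrableOn_empty
  · refine (hφ _ (hkJ (hk.sInf_mem hne)) (sSup k)).mono_set fun t ht => ?_
    exact ⟨csInf_le hk.bddBelow ht, le_csSup hk.bddAbove ht⟩

theorem mem_Avnull_iff : φ ∈ Avnull J α₀ ↔
    LocallyIntegrableOn φ J ∧ IsErgodicMean {α₀} (fun t => ‖φ t‖) 0 := by
  refine and_congr_right fun _ => forall₂_congr fun ε _ => ⟨?_, ?_⟩
  · rintro ⟨T₀, hT₀⟩
    refine ⟨max T₀ 1, ?_⟩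
    rintro T hT _ rfl
    simp only [ge_iff_le, max_le_iff] at hT
    rw [sub_zero, Real.norm_of_nonneg (meanM_norm_nonneg (by linarith)), meanM_eq]
    exact hT₀ T hT.1
  · rintro ⟨T₀, hT₀⟩
    refine ⟨T₀, fun T hT => ?_⟩
    have h := (Real.le_norm_self _).trans (hT₀ T hT α₀ rfl)
    rwa [sub_zero, meanM_eq] at h

variable [NormedSpace ℝ X]

theorem mem_Av0_iff : φ ∈ Av0 J α₀ ↔
    LocallyIntegrableOn φ J ∧ IsErgodicMean {α₀} φ 0 := by
  simp [Av0, IsErgodicMean, meanM_eq]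

theorem mem_ergEnull_iff : φ ∈ ergEnull J ↔
    LocallyIntegrableOn φ J ∧ IsErgodicMean J (fun t => ‖φ t‖) 0 :=
  ⟨fun h => ⟨h.1.1, h.2.2⟩, fun h => ⟨⟨h.1, 0, h.2.of_norm⟩, h.1.norm, h.2⟩⟩

end Interval

/-- Proposition 7.3.  The classes `ℰ₀`, `ℰ_n`, `Av₀`, `Av_n`
all satisfy condition (Δ). -/
theorem prop_7_3 {X : Type*} [NormedAddCommGroup X] [NormedSpace ℝ X] [CompleteSpace X]
    (J : Set ℝ) (α₀ : ℝ)
    (hJ : (J = Set.univ ∧ α₀ = 0) ∨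
      ∃ α : ℝ, (J = Set.Ioi α ∨ J = Set.Ici α) ∧ α₀ = α + 1) :
    deltaCond J (ergE0 (X := X) J) ∧ deltaCond J (ergEnull (X := X) J) ∧
      deltaCond J (Av0 (X := X) J α₀) ∧ deltaCond J (Avnull (X := X) J α₀) := by
  obtain ⟨hJl, hJr, hα⟩ : IsLocallyClosed J ∧ (∀ x ∈ J, Ici x ⊆ J) ∧ α₀ ∈ J := by
    rcases hJ with ⟨rfl, rfl⟩ | ⟨α, rfl | rfl, rfl⟩
    · exact ⟨isOpen_univ.isLocallyClosed, fun _ _ => subset_univ _, mem_univ _⟩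
    · exact ⟨isOpen_Ioi.isLocallyClosed, fun _ hx => Ici_subset_Ioi.2 hx, by simp⟩
    · exact ⟨isClosed_Ici.isLocallyClosed, fun _ hx => Ici_subset_Ici.2 hx, by simp⟩
  have hfrom : ∀ {f : ℝ → X}, LocallyIntegrableOn f J → ∀ x ∈ J, IntegrableFrom f x :=
    fun hf x hx => hf.integrableFrom (hJr x hx)
  have hsingle : ∀ {f : ℝ → X}, LocallyIntegrableOn f J →
      ∀ x ∈ ({α₀} : Set ℝ), IntegrableFrom f x := by
    rintro f hf _ rfl
    exact hfrom hf _ hα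
  have hloc : ∀ {φ : ℝ → X}, LocallyIntegrableOn φ J → ∀ {h : ℝ}, 0 < h →
      LocallyIntegrableOn (fun t => φ t - meanM h φ t) J := fun hφ h hh =>
    locallyIntegrableOn_of_integrableFrom hJl fun x hx =>
      (hfrom hφ x hx).sub ((hfrom hφ x hx).meanM hh.le)
  refine ⟨fun φ hφ hΔ h hh => ?_, fun φ hφ hΔ h hh => ?_, fun φ hφ hΔ h hh => ?_,
    fun φ hφ hΔ h hh => ?_⟩
  · exact ⟨hloc hφ hh, isErgodicMean_sub_meanM (hfrom hφ)
      (fun s hs => (hΔ s hs).2.uniformlyNullOnShifts hJr) hh⟩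
  · exact mem_ergEnull_iff.2 ⟨hloc hφ hh, isErgodicMean_norm_sub_meanM (hfrom hφ)
      (fun s hs => (mem_ergEnull_iff.1 (hΔ s hs)).2.uniformlyNullOnShifts hJr) hh⟩
  · refine mem_Av0_iff.2 ⟨hloc hφ hh, isErgodicMean_sub_meanM (hsingle hφ) (fun s hs => ?_) hh⟩
    have hs' := mem_Av0_iff.1 (hΔ s hs)
    exact hs'.2.uniformlyNullOnShifts_singleton (hfrom hs'.1 _ hα)
  · refine mem_Avnull_iff.2
      ⟨hloc hφ hh, isErgodicMean_norm_sub_meanM (hsingle hφ) (fun s hs => ?_) hh⟩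
    have hs' := mem_Avnull_iff.1 (hΔ s hs)
    exact hs'.2.uniformlyNullOnShifts_singleton (hfrom hs'.1 _ hα).norm
end

section
/- Let 𝕁 be an interval of the form ℝ, (α,∞) or [α,∞) and X a Banach space. If u ∈ Av_n(𝕁,X) and w ∈ r₊(𝕁,X) ∩ C(𝕁,X), then w(𝕁) is contained in the closure in X of (u+w)(𝕁); consequently sup_{t∈𝕁} ‖w(t)‖ ≤ sup_{t∈𝕁} ‖u(t) + w(t)‖ (Porada's inequality). -/
open MeasureTheory Set

/-- `M ⊆ [0,∞)` is relatively dense in `[0,∞)`: some length `l > 0` has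
`M ∩ [s, s+l] ≠ ∅` for all `s ≥ 0`. -/
def RelativelyDensePos (M : Set ℝ) : Prop :=
  ∃ l : ℝ, 0 < l ∧ ∀ s : ℝ, 0 ≤ s → ∃ τ ∈ M, τ ∈ Set.Icc s (s + l)

/-- The set of `(ε,n)`-translation numbers
`T₊(φ,ε,n) = {τ ≥ 0 : ‖φ(t+τ) − φ(t)‖ ≤ ε for all t ∈ 𝕁, |t| ≤ n}`. -/
def Tplus {X : Type*} [NormedAddCommGroup X] (J : Set ℝ) (φ : ℝ → X) (ε : ℝ) (n : ℕ) :
    Set ℝ :=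
  {τ | 0 ≤ τ ∧ ∀ t ∈ J, |t| ≤ (n : ℝ) → ‖φ (t + τ) - φ t‖ ≤ ε}

/-- The recurrent functions `r₊(𝕁,X)`. -/
def recPlus {X : Type*} [NormedAddCommGroup X] (J : Set ℝ) : Set (ℝ → X) :=
  {φ | ∀ n : ℕ, 0 < n → RelativelyDensePos (Tplus J φ (1 / (n : ℝ)) n)}

/-- The integral of a nonnegative integrable function on `[a, b]` dominates the contribution of
a subinterval on which the function is bounded below. -/
theorem mul_le_integral_of_le_on_subinterval {f : ℝ → ℝ} {a b p δ m : ℝ} (hδ : 0 ≤ δ)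
    (hf0 : ∀ x, 0 ≤ f x) (hf : IntervalIntegrable f volume a b) (hap : a ≤ p) (hpb : p + δ ≤ b)
    (hm : ∀ x ∈ Icc p (p + δ), m ≤ f x) : δ * m ≤ ∫ x in a..b, f x := by
  have hsub : IntervalIntegrable f volume p (p + δ) := by
    apply hf.mono_set
    rw [uIcc_of_le (by linarith), uIcc_of_le (by linarith)]
    exact Icc_subset_Icc hap hpb
  calc δ * m = ∫ _ in p..(p + δ), m := by simp
    _ ≤ ∫ x in p..(p + δ), f x :=
      intervalIntegral.integral_mono_on (by linarith) intervalIntegrable_const hsub hm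
    _ ≤ ∫ x in a..b, f x :=
      intervalIntegral.integral_mono_interval hap (by linarith) hpb
        (Filter.Eventually.of_forall hf0) hf

/-- If every window of length `L` to the right of `b` contributes at least `m`, then `N`
consecutive windows contribute at least `N * m`. -/
theorem nat_mul_le_integral_of_le_integral_window {f : ℝ → ℝ} {b L m : ℝ} (hL : 0 ≤ L)
    (hf : ∀ x y, b ≤ x → b ≤ y → IntervalIntegrable f volume x y)
    (hm : ∀ a, b ≤ a → m ≤ ∫ x in a..(a + L), f x) (N : ℕ) :
    N * m ≤ ∫ x in b..(b + N * L), f x := by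
  induction N with
  | zero => simp
  | succ N ih =>
    have hN : b ≤ b + N * L := by
      have : 0 ≤ N * L := by positivity
      linarith
    have hstep := hm (b + N * L) hN
    rw [← intervalIntegral.integral_add_adjacent_intervals (hf b (b + N * L) le_rfl hN)
      (hf _ _ hN (by push_cast; linarith))]
    have he : b + ((N + 1 : ℕ) : ℝ) * L = b + N * L + L := by push_cast; ring
    rw [he]
    push_cast
    linarith

/-- A locally integrable function on an upward closed set whose norm carries a fixed mass
in every far enough window of fixed length does not have mean zero. -/
theorem notMem_Avnull_of_le_integral_window {X : Type*} [NormedAddCommGroup X] {J : Set ℝ}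
    {α₀ b L m : ℝ} (hJ : IsUpperSet J) (hα₀ : α₀ ∈ J) (hb : α₀ ≤ b) (hL : 0 < L) (hm : 0 < m)
    {u : ℝ → X} (hwin : ∀ a, b ≤ a → m ≤ ∫ x in a..(a + L), ‖u x‖) :
    u ∉ Avnull J α₀ := by
  rintro ⟨hloc, hmean⟩
  have hint : ∀ x y, α₀ ≤ x → α₀ ≤ y → IntervalIntegrable (fun t => ‖u t‖) volume x y := by
    intro x y hx hy
    have : IntegrableOn u (uIcc x y) :=
      hloc.integrableOn_compact_subset
        (fun z hz => hJ ((le_min hx hy).trans hz.1) hα₀) isCompact_uIcc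
    exact this.intervalIntegrable.norm
  obtain ⟨T₀, hT₀⟩ := hmean (m / (4 * L)) (by positivity)
  obtain ⟨N, hN⟩ := exists_nat_gt (max (|T₀| / L) ((b - α₀) / L))
  have hN1 : |T₀| < N * L := (div_lt_iff₀ hL).1 ((le_max_left _ _).trans_lt hN)
  have hN2 : b - α₀ < N * L := (div_lt_iff₀ hL).1 ((le_max_right _ _).trans_lt hN)
  have hNL : 0 < N * L := (abs_nonneg _).trans_lt hN1
  set T := b - α₀ + N * L with hT
  have hTpos : 0 < T := by linarith
  have hmain := hT₀ T (by linarith [le_abs_self T₀])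
  have hlow := nat_mul_le_integral_of_le_integral_window hL.le
    (fun x y hx hy => hint x y (hb.trans hx) (hb.trans hy)) hwin N
  have hmono : ∫ x in b..(b + N * L), ‖u x‖ ≤ ∫ x in α₀..(α₀ + T), ‖u x‖ :=
    intervalIntegral.integral_mono_interval hb (by linarith) (by linarith)
      (Filter.Eventually.of_forall fun x => norm_nonneg (u x))
      (hint _ _ le_rfl (by linarith))
  rw [one_div, inv_mul_le_iff₀ hTpos] at hmain
  have h1 : T * (m / (4 * L)) ≤ (2 * (N * L)) * (m / (4 * L)) := by gcongr; linarith
  have h2 : (2 * (N * L)) * (m / (4 * L)) = N * m / 2 := by field_simp; ring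
  have h3 : 0 < N * m := mul_pos (pos_of_mul_pos_left hNL hL.le) hm
  linarith

/-- On an upward closed set, the values of a continuous recurrent function lie in the closure of
the range of its sum with any mean-zero function. -/
theorem mem_closure_image_add_of_mem_Avnull_of_mem_recPlus {X : Type*} [NormedAddCommGroup X]
    {J : Set ℝ} {α₀ : ℝ} (hJ : IsUpperSet J) (hα₀ : α₀ ∈ J) {u w : ℝ → X} (hu : u ∈ Avnull J α₀)
    (hw : w ∈ recPlus J) (hwc : ContinuousOn w J) {t₀ : ℝ} (ht₀ : t₀ ∈ J) :
    w t₀ ∈ closure ((fun t => u t + w t) '' J) := by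
  by_contra hnot
  rw [Metric.mem_closure_iff] at hnot
  push Not at hnot
  obtain ⟨ε, hε, hfar⟩ := hnot
  obtain ⟨δ', hδ', hcont⟩ := Metric.continuousOn_iff.1 hwc t₀ ht₀ (ε / 4) (by positivity)
  obtain ⟨δ, hδ, hδlt⟩ : ∃ δ, 0 < δ ∧ δ < min δ' 1 := exists_between (lt_min hδ' one_pos)
  have hδ1 : δ < 1 := hδlt.trans_le (min_le_right _ _)
  have hδδ' : δ < δ' := hδlt.trans_le (min_le_left _ _)
  obtain ⟨n, hn⟩ := exists_nat_gt (max (4 / ε) (|t₀| + 1))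
  have hn1 : 4 / ε < n := (le_max_left _ _).trans_lt hn
  have hn2 : |t₀| + 1 < n := (le_max_right _ _).trans_lt hn
  have hnpos : (0 : ℝ) < n := (by positivity : (0 : ℝ) < 4 / ε).trans hn1
  have hinv : 1 / (n : ℝ) ≤ ε / 4 := by
    rw [div_lt_iff₀ hε] at hn1
    rw [div_le_div_iff₀ hnpos (by norm_num)]
    linarith
  obtain ⟨l, hl, hdense⟩ := hw n (by exact_mod_cast hnpos)
  have hfarw : ∀ τ ∈ Tplus J w (1 / (n : ℝ)) n, ∀ x ∈ Icc (t₀ + τ) (t₀ + τ + δ),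
      ε / 2 ≤ ‖u x‖ := by
    rintro τ ⟨hτ0, hτ⟩ x ⟨hx1, hx2⟩
    have hyJ : x - τ ∈ J := hJ (by linarith) ht₀
    have hy : |x - τ - t₀| ≤ δ := abs_le.2 ⟨by linarith, by linarith⟩
    have hyn : |x - τ| ≤ n := by
      have := abs_add_le (x - τ - t₀) t₀
      rw [sub_add_cancel] at this
      linarith
    have h1 := hτ (x - τ) hyJ hyn
    rw [sub_add_cancel] at h1
    have h2 := hcont (x - τ) hyJ (by rw [Real.dist_eq]; linarith)
    rw [dist_eq_norm] at h2
    have h3 := hfar _ (mem_image_of_mem (fun t => u t + w t) (hJ (by linarith : t₀ ≤ x) ht₀))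
    rw [dist_comm, dist_eq_norm] at h3
    have h4 : u x + w x - w t₀ = u x + (w x - w (x - τ)) + (w (x - τ) - w t₀) := by abel
    have h5 := norm_add₃_le (a := u x) (b := w x - w (x - τ)) (c := w (x - τ) - w t₀)
    simp only [h4] at h3
    linarith
  refine notMem_Avnull_of_le_integral_window hJ hα₀ (le_max_left α₀ t₀) (by linarith : 0 < l + 1)
    (by positivity : 0 < δ * (ε / 2)) (fun a ha => ?_) hu
  have haα : α₀ ≤ a := (le_max_left _ _).trans ha
  obtain ⟨τ, hτ, hτ1, hτ2⟩ := hdense (a - t₀) (by linarith [le_max_right α₀ t₀])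
  have hint : IntegrableOn u (uIcc a (a + (l + 1))) :=
    hu.1.integrableOn_compact_subset
      (fun z hz => hJ ((le_min haα (by linarith)).trans hz.1) hα₀) isCompact_uIcc
  exact mul_le_integral_of_le_on_subinterval hδ.le (fun x => norm_nonneg (u x))
    hint.intervalIntegrable.norm (by linarith : a ≤ t₀ + τ) (by linarith) (hfarw τ hτ)

/-- Porada's inequality, (7.7)/(7.8).  If `u ∈ Av_n(𝕁,X)` and
`w ∈ r₊(𝕁,X) ∩ C(𝕁,X)`, then `w(𝕁) ⊆ closure((u+w)(𝕁))`, and consequently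
`sup_𝕁 ‖w‖ ≤ sup_𝕁 ‖u + w‖`. -/
theorem porada {X : Type*} [NormedAddCommGroup X] [NormedSpace ℝ X] [CompleteSpace X]
    (J : Set ℝ) (α₀ : ℝ)
    (hJ : (J = Set.univ ∧ α₀ = 0) ∨
      ∃ α : ℝ, (J = Set.Ioi α ∨ J = Set.Ici α) ∧ α₀ = α + 1)
    (u w : ℝ → X)
    (hu : u ∈ Avnull (X := X) J α₀)
    (hw : w ∈ recPlus (X := X) J) (hwc : ContinuousOn w J) :
    (∀ t ∈ J, w t ∈ closure ((fun t => u t + w t) '' J)) ∧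
    ∀ C : ℝ, (∀ t ∈ J, ‖u t + w t‖ ≤ C) → ∀ t ∈ J, ‖w t‖ ≤ C := by
  have hupper : IsUpperSet J := by
    rcases hJ with ⟨rfl, -⟩ | ⟨α, rfl | rfl, -⟩
    exacts [isUpperSet_univ, isUpperSet_Ioi α, isUpperSet_Ici α]
  have hα₀ : α₀ ∈ J := by
    rcases hJ with ⟨rfl, -⟩ | ⟨α, rfl | rfl, rfl⟩ <;> simp
  have hclosure : ∀ t ∈ J, w t ∈ closure ((fun t => u t + w t) '' J) := fun t ht =>
    mem_closure_image_add_of_mem_Avnull_of_mem_recPlus hupper hα₀ hu hw hwc ht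
  refine ⟨hclosure, fun C hC t ht => ?_⟩
  refine closure_minimal ?_ (isClosed_le continuous_norm continuous_const) (hclosure t ht)
  rintro _ ⟨s, hs, rfl⟩
  exact hC s hs
end
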